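/- arXiv:2001.05903 — 2 statements merged into one kernel-verified Lean document; each statement's English description precedes it below -/
import Mathlib

section
/- Quasi-triangle inequality in the upper half space (Theorem 1.2(iii)): For every 1 ≤ p ≤ ∞ and 1 ≤ r ≤ ∞ there exists a constant C = C(p,r) such that for every sequence {f_n}_{n∈ℕ} of nonnegative Borel functions on X = ℝ^d × (0,∞), ‖Σ_{n∈ℕ} f_n‖_{L^p(ℓ^r)} ≤ C Σ_{n∈ℕ} ‖f_n‖_{L^p(ℓ^r)}. In particular, for 1 ≤ p, r ≤ ∞ the outer L^p(ℓ^r) quasi-norm is equivalent to a norm. -/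
open MeasureTheory Set
open scoped ENNReal

noncomputable section

/-- The outer `ℓ^r` size associated with an outer measure `μ` and a Borel measure `ν`:
for `r < ∞`, `ℓ^r(f)(A) = (μ(A)⁻¹ ∫_A f^r dν)^{1/r}`; for `r = ∞` the `ν`-essential
supremum of `f` on `A`. -/
def ellSize {X : Type*} [MeasurableSpace X] (μ : Set X → ℝ≥0∞) (ν : MeasureTheory.Measure X)
    (r : ℝ≥0∞) (f : X → ℝ≥0∞) (A : Set X) : ℝ≥0∞ :=
  if r = ∞ then essSup f (ν.restrict A)
  else ((μ A)⁻¹ * ∫⁻ x in A, f x ^ r.toReal ∂ν) ^ r.toReal⁻¹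

/-- The outer `L^∞(ℓ^r)` quasi-norm: supremum of the size over Borel sets. -/
def outerSup {X : Type*} [MeasurableSpace X] (μ : Set X → ℝ≥0∞) (ν : MeasureTheory.Measure X)
    (r : ℝ≥0∞) (f : X → ℝ≥0∞) : ℝ≥0∞ :=
  ⨆ (A : Set X) (_ : MeasurableSet A), ellSize μ ν r f A

/-- The super level measure `μ(ℓ^r(f) > λ)`. -/
def superLevel {X : Type*} [MeasurableSpace X] (μ : Set X → ℝ≥0∞) (ν : MeasureTheory.Measure X)
    (r : ℝ≥0∞) (f : X → ℝ≥0∞) (lam : ℝ≥0∞) : ℝ≥0∞ :=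
  ⨅ (A : Set X) (_ : MeasurableSet A)
    (_ : outerSup μ ν r (Aᶜ.indicator f) ≤ lam), μ A

/-- The outer `L^p(ℓ^r)` quasi-norm,
`‖f‖_{L^p(ℓ^r)} = (∫_0^∞ p λ^{p-1} μ(ℓ^r(f) > λ) dλ)^{1/p}` for `p < ∞`. -/
def outerLp {X : Type*} [MeasurableSpace X] (μ : Set X → ℝ≥0∞) (ν : MeasureTheory.Measure X)
    (p r : ℝ≥0∞) (f : X → ℝ≥0∞) : ℝ≥0∞ :=
  if p = ∞ then outerSup μ ν r f
  else (∫⁻ l in Ioi (0:ℝ),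
      ENNReal.ofReal (p.toReal * l ^ (p.toReal - 1)) *
        superLevel μ ν r f (ENNReal.ofReal l)) ^ p.toReal⁻¹

/-- The weak outer `L^{p,∞}(ℓ^r)` quasi-norm,
`‖f‖_{L^{p,∞}(ℓ^r)} = (sup_{λ>0} λ^p μ(ℓ^r(f) > λ))^{1/p}` for `p < ∞`. -/
def outerLpWeak {X : Type*} [MeasurableSpace X] (μ : Set X → ℝ≥0∞) (ν : MeasureTheory.Measure X)
    (p r : ℝ≥0∞) (f : X → ℝ≥0∞) : ℝ≥0∞ :=
  if p = ∞ then outerSup μ ν r f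
  else (⨆ (lam : ℝ≥0∞) (_ : 0 < lam), lam ^ p.toReal * superLevel μ ν r f lam) ^ p.toReal⁻¹

/-- The upper half space `ℝ^d × ℝ` (only the part `t > 0` carries mass). -/
abbrev UHS (d : ℕ) : Type := (Fin d → ℝ) × ℝ

/-- The measure `t⁻¹ dy dt` on the upper half space (vanishing on `{t ≤ 0}`). -/
def uhsMeasure (d : ℕ) : MeasureTheory.Measure (UHS d) :=
  (MeasureTheory.volume : MeasureTheory.Measure (Fin d → ℝ)).prod
    (MeasureTheory.volume.withDensity fun t => ENNReal.ofReal t⁻¹)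

/-- The open dyadic box `(x,0) + (0,2^j)^{d+1}` with `x = 2^j k`, `k ∈ ℤ^d`. -/
def dyadicBox (d : ℕ) (j : ℤ) (k : Fin d → ℤ) : Set (UHS d) :=
  {q | (∀ i, q.1 i ∈ Ioo ((2:ℝ) ^ j * k i) ((2:ℝ) ^ j * k i + (2:ℝ) ^ j)) ∧
    q.2 ∈ Ioo 0 ((2:ℝ) ^ j)}

/-- The pre-measure of a dyadic box of scale `2^j`: the volume `2^{jd}` of its base. -/
def dyadicVol (d : ℕ) (j : ℤ) : ℝ≥0∞ := ENNReal.ofReal ((2:ℝ) ^ j) ^ d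

/-- The outer measure on the upper half space generated by covering with dyadic boxes. -/
def dyadicOuter (d : ℕ) (A : Set (UHS d)) : ℝ≥0∞ :=
  ⨅ (C : Set (ℤ × (Fin d → ℤ))) (_ : A ⊆ ⋃ e ∈ C, dyadicBox d e.1 e.2),
    ∑' e : C, dyadicVol d e.1.1

/-- The open dyadic cube that is the base of the dyadic box with index `Q`. -/
def dyadicCube (d : ℕ) (Q : ℤ × (Fin d → ℤ)) : Set (Fin d → ℝ) :=
  {y | ∀ i, y i ∈ Ioo ((2:ℝ) ^ Q.1 * Q.2 i) ((2:ℝ) ^ Q.1 * Q.2 i + (2:ℝ) ^ Q.1)}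

/-- The Whitney region of a dyadic box: its upper half. -/
def whitney (d : ℕ) (Q : ℤ × (Fin d → ℤ)) : Set (UHS d) :=
  {q | q.1 ∈ dyadicCube d Q ∧ q.2 ∈ Ico ((2:ℝ) ^ (Q.1 - 1)) ((2:ℝ) ^ Q.1)}

section Geometry

variable {d : ℕ}

lemma dyadicCube_eq_pi (Q : ℤ × (Fin d → ℤ)) :
    dyadicCube d Q =
      univ.pi fun i => Ioo ((2:ℝ) ^ Q.1 * Q.2 i) ((2:ℝ) ^ Q.1 * Q.2 i + (2:ℝ) ^ Q.1) := by
  ext y; simp [dyadicCube]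

lemma measurableSet_dyadicCube (Q : ℤ × (Fin d → ℤ)) : MeasurableSet (dyadicCube d Q) := by
  rw [dyadicCube_eq_pi]
  exact MeasurableSet.univ_pi fun i => measurableSet_Ioo

lemma measurableSet_dyadicBox (Q : ℤ × (Fin d → ℤ)) :
    MeasurableSet (dyadicBox d Q.1 Q.2) :=
  (measurable_fst (measurableSet_dyadicCube Q)).inter (measurable_snd measurableSet_Ioo)

lemma measurableSet_whitney (Q : ℤ × (Fin d → ℤ)) : MeasurableSet (whitney d Q) :=
  (measurable_fst (measurableSet_dyadicCube Q)).inter (measurable_snd measurableSet_Ico)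

lemma whitney_subset_dyadicBox (Q : ℤ × (Fin d → ℤ)) : whitney d Q ⊆ dyadicBox d Q.1 Q.2 :=
  fun _ hq => ⟨hq.1, lt_of_lt_of_le (by positivity) hq.2.1, hq.2.2⟩

lemma volume_dyadicCube (Q : ℤ × (Fin d → ℤ)) : volume (dyadicCube d Q) = dyadicVol d Q.1 := by
  rw [dyadicCube_eq_pi, Real.volume_pi_Ioo]
  simp [dyadicVol]

lemma dyadicVol_ne_zero (j : ℤ) : dyadicVol d j ≠ 0 := by
  have : (0:ℝ) < 2 ^ j := by positivity
  simp [dyadicVol, this]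

lemma dyadicVol_ne_top (j : ℤ) : dyadicVol d j ≠ ∞ := by
  simp [dyadicVol]

/-- Intersecting dyadic cubes are nested. -/
lemma dyadicCube_subset {Q R : ℤ × (Fin d → ℤ)} (h : Q.1 ≤ R.1) {y : Fin d → ℝ}
    (hQ : y ∈ dyadicCube d Q) (hR : y ∈ dyadicCube d R) : dyadicCube d Q ⊆ dyadicCube d R := by
  intro z hz i
  have h1 := hQ i
  have h2 := hR i
  have h3 := hz i
  obtain ⟨n, hn⟩ := Int.eq_ofNat_of_zero_le (sub_nonneg.2 h)
  have hpos : (0:ℝ) < 2 ^ Q.1 := by positivity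
  have hRe : (2:ℝ) ^ R.1 = 2 ^ Q.1 * ((2 ^ n : ℤ) : ℝ) := by
    rw [show R.1 = Q.1 + n by omega, zpow_add₀ (by norm_num)]; simp
  rw [hRe] at h2 ⊢
  set a : ℤ := 2 ^ n
  set s : ℝ := 2 ^ Q.1
  have e1 : ((Q.2 i : ℤ) : ℝ) < ((a * R.2 i + a : ℤ) : ℝ) := by
    push_cast
    refine lt_of_mul_lt_mul_left ?_ hpos.le
    nlinarith [h1.1, h2.2]
  have e2 : ((a * R.2 i : ℤ) : ℝ) < ((Q.2 i + 1 : ℤ) : ℝ) := by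
    push_cast
    refine lt_of_mul_lt_mul_left ?_ hpos.le
    nlinarith [h1.2, h2.1]
  have f1 : (((Q.2 i + 1 : ℤ)) : ℝ) ≤ ((a * R.2 i + a : ℤ) : ℝ) := by
    exact_mod_cast Int.add_one_le_iff.2 (by exact_mod_cast e1)
  have f2 : ((a * R.2 i : ℤ) : ℝ) ≤ ((Q.2 i : ℤ) : ℝ) := by
    exact_mod_cast Int.lt_add_one_iff.1 (by exact_mod_cast e2)
  push_cast at f1 f2
  constructor
  · nlinarith [h3.1]
  · nlinarith [h3.2]

lemma dyadicCube_eq_of_mem {Q R : ℤ × (Fin d → ℤ)} (h : Q.1 = R.1) {y : Fin d → ℝ}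
    (hQ : y ∈ dyadicCube d Q) (hR : y ∈ dyadicCube d R) : Q = R := by
  refine Prod.ext h (funext fun i => ?_)
  have h1 := hQ i
  have h2 := hR i
  rw [← h] at h2
  have hpos : (0:ℝ) < 2 ^ Q.1 := by positivity
  have e1 : ((Q.2 i : ℤ) : ℝ) < ((R.2 i + 1 : ℤ) : ℝ) := by
    push_cast
    refine lt_of_mul_lt_mul_left ?_ hpos.le
    nlinarith [h1.1, h2.2]
  have e2 : ((R.2 i : ℤ) : ℝ) < ((Q.2 i + 1 : ℤ) : ℝ) := by
    push_cast
    refine lt_of_mul_lt_mul_left ?_ hpos.le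
    nlinarith [h1.2, h2.1]
  have e1' : Q.2 i < R.2 i + 1 := by exact_mod_cast e1
  have e2' : R.2 i < Q.2 i + 1 := by exact_mod_cast e2
  omega

lemma dyadicBox_subset {Q R : ℤ × (Fin d → ℤ)} (h : Q.1 ≤ R.1)
    (hs : dyadicCube d Q ⊆ dyadicCube d R) : dyadicBox d Q.1 Q.2 ⊆ dyadicBox d R.1 R.2 :=
  fun _ hq => ⟨hs hq.1, hq.2.1, hq.2.2.trans_le (zpow_le_zpow_right₀ (by norm_num) h)⟩

/-- A dyadic box that meets a Whitney region contains the whole box of that region. -/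
lemma dyadicCube_subset_of_whitney {Q R : ℤ × (Fin d → ℤ)} {q : UHS d}
    (hQ : q ∈ whitney d Q) (hR : q ∈ dyadicBox d R.1 R.2) :
    Q.1 ≤ R.1 ∧ dyadicCube d Q ⊆ dyadicCube d R := by
  have hle : Q.1 ≤ R.1 := by
    have h1 : (2:ℝ) ^ (Q.1 - 1) < 2 ^ R.1 := hQ.2.1.trans_lt hR.2.2
    have := (zpow_lt_zpow_iff_right₀ (by norm_num : (1:ℝ) < 2)).1 h1
    omega
  exact ⟨hle, dyadicCube_subset hle hQ.1 hR.1⟩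

lemma pairwise_disjoint_whitney : Pairwise (Function.onFun Disjoint (whitney d)) := by
  intro Q R hne
  refine Set.disjoint_left.2 fun q hQ hR => hne ?_
  have h1 := (dyadicCube_subset_of_whitney hQ (whitney_subset_dyadicBox R hR)).1
  have h2 := (dyadicCube_subset_of_whitney hR (whitney_subset_dyadicBox Q hQ)).1
  exact dyadicCube_eq_of_mem (le_antisymm h1 h2) hQ.1 hR.1

/-- The Whitney regions cover almost all of the upper half space. -/
lemma ae_mem_iUnion_whitney : ∀ᵐ q ∂uhsMeasure d, q ∈ ⋃ Q, whitney d Q := by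
  have h1 : ∀ᵐ y : Fin d → ℝ, ∀ (i : Fin d) (j k : ℤ), y i ≠ (2:ℝ) ^ j * k := by
    refine ae_all_iff.2 fun i => ae_all_iff.2 fun j => ae_all_iff.2 fun k => ?_
    have := Measure.pi_hyperplane (fun _ : Fin d => (volume : Measure ℝ)) i ((2:ℝ) ^ j * k)
    rw [ae_iff]
    simpa [volume_pi] using this
  have h2 : ∀ᵐ t ∂(volume.withDensity fun t : ℝ => ENNReal.ofReal t⁻¹), 0 < t := by
    rw [ae_withDensity_iff (by fun_prop)]
    refine ae_of_all _ fun t ht => ?_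
    simpa using ht
  have h1' : ∀ᵐ q ∂uhsMeasure d, ∀ (i : Fin d) (j k : ℤ), q.1 i ≠ (2:ℝ) ^ j * k :=
    Measure.quasiMeasurePreserving_fst.ae h1
  have h2' : ∀ᵐ q ∂uhsMeasure d, 0 < q.2 := Measure.quasiMeasurePreserving_snd.ae h2
  filter_upwards [h1', h2'] with q hq ht
  obtain ⟨j, hj1, hj2⟩ := exists_mem_Ico_zpow ht (one_lt_two : (1:ℝ) < 2)
  refine mem_iUnion.2 ⟨(j + 1, fun i => ⌊q.1 i / 2 ^ (j + 1)⌋), fun i => ?_, by simpa using hj1, hj2⟩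
  have hpos : (0:ℝ) < 2 ^ (j + 1) := by positivity
  have f1 := Int.floor_le (q.1 i / 2 ^ (j + 1))
  have f2 := Int.lt_floor_add_one (q.1 i / 2 ^ (j + 1))
  rw [le_div_iff₀ hpos] at f1
  rw [div_lt_iff₀ hpos] at f2
  refine ⟨lt_of_le_of_ne (by linarith) (hq i _ _).symm, by simp only; linarith⟩

lemma lintegral_eq_tsum_whitney (g : UHS d → ℝ≥0∞) {A : Set (UHS d)} (hA : MeasurableSet A) :
    ∫⁻ q in A, g q ∂uhsMeasure d = ∑' Q, ∫⁻ q in whitney d Q ∩ A, g q ∂uhsMeasure d := by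
  rw [← lintegral_iUnion (fun Q => (measurableSet_whitney Q).inter hA)
    (fun Q R h => (pairwise_disjoint_whitney h).mono inter_subset_left inter_subset_left)]
  refine setLIntegral_congr ?_
  rw [← iUnion_inter]
  filter_upwards [ae_mem_iUnion_whitney] with q hq
  exact propext ⟨fun h => ⟨hq, h⟩, fun h => h.2⟩

/-- The volume of dyadic boxes of bounded volume is bounded, in positive dimension. -/
lemma exists_scale_bound (hd : d ≠ 0) {T : ℝ≥0∞} (hT : T ≠ ∞) :
    ∃ J : ℤ, ∀ j : ℤ, dyadicVol d j ≤ T → j ≤ J := by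
  obtain ⟨n, hn⟩ := pow_unbounded_of_one_lt T.toReal (one_lt_two : (1:ℝ) < 2)
  refine ⟨n, fun j hj => ?_⟩
  by_contra! hlt
  have hle : (2:ℝ) ^ n ≤ 2 ^ j := by
    rw [← zpow_natCast]
    exact zpow_le_zpow_right₀ (by norm_num) hlt.le
  have h1 : (1:ℝ) ≤ 2 ^ j := le_trans (one_le_pow₀ (by norm_num)) hle
  have h2 : ((2:ℝ) ^ j) ^ d ≤ T.toReal := by
    rw [dyadicVol, ← ENNReal.ofReal_pow (by positivity)] at hj
    exact (ENNReal.ofReal_le_iff_le_toReal hT).1 hj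
  linarith [le_self_pow₀ h1 hd]

/-- Selection of maximal cubes: if disjoint subfamilies of `S` have total volume at most `T`,
then `S` is dominated by a subfamily of total volume at most `T`. -/
lemma exists_maximal_cubes (hd : d ≠ 0) {T : ℝ≥0∞} (hT : T ≠ ∞) (S : Set (ℤ × (Fin d → ℤ)))
    (h : ∀ M ⊆ S, M.PairwiseDisjoint (dyadicCube d) → ∑' Q : M, dyadicVol d Q.1.1 ≤ T) :
    ∃ M ⊆ S, ∑' Q : M, dyadicVol d Q.1.1 ≤ T ∧
      ∀ Q ∈ S, ∃ R ∈ M, Q.1 ≤ R.1 ∧ dyadicCube d Q ⊆ dyadicCube d R := by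
  obtain ⟨J, hJ⟩ := exists_scale_bound hd hT
  have hS : ∀ Q ∈ S, Q.1 ≤ J := fun Q hQ => hJ _ (by
    simpa using h {Q} (by simpa using hQ) (pairwiseDisjoint_singleton _ _))
  let M := {R ∈ S | ∀ G ∈ S, dyadicCube d R ⊆ dyadicCube d G → G.1 ≤ R.1}
  have hM : M ⊆ S := fun R hR => hR.1
  have aux : ∀ R ∈ M, ∀ G ∈ M, R.1 ≤ G.1 → ∀ y, y ∈ dyadicCube d R → y ∈ dyadicCube d G →
      R = G := fun R hR G hG hle y hyR hyG =>
    dyadicCube_eq_of_mem (le_antisymm hle (hR.2 G hG.1 (dyadicCube_subset hle hyR hyG))) hyR hyG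
  refine ⟨M, hM, h M hM ?_, fun Q hQ => ?_⟩
  · intro R hR G hG hne
    refine Set.disjoint_left.2 fun y hyR hyG => hne ?_
    rcases le_total R.1 G.1 with hle | hle
    · exact aux R hR G hG hle y hyR hyG
    · exact (aux G hG R hR hle y hyG hyR).symm
  · obtain ⟨j, ⟨R, hR, hQR, rfl⟩, hmax⟩ := Int.exists_greatest_of_bdd
      (P := fun j => ∃ R ∈ S, dyadicCube d Q ⊆ dyadicCube d R ∧ R.1 = j)
      ⟨J, by rintro z ⟨R, hR, -, rfl⟩; exact hS R hR⟩ ⟨Q.1, Q, hQ, Subset.rfl, rfl⟩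
    exact ⟨R, ⟨hR, fun G hG hRG => hmax _ ⟨G, hG, hQR.trans hRG, rfl⟩⟩,
      hmax _ ⟨Q, hQ, Subset.rfl, rfl⟩, hQR⟩

lemma dyadicOuter_le_tsum {A : Set (UHS d)} (M : Set (ℤ × (Fin d → ℤ)))
    (h : A ⊆ ⋃ Q ∈ M, dyadicBox d Q.1 Q.2) : dyadicOuter d A ≤ ∑' Q : M, dyadicVol d Q.1.1 :=
  iInf₂_le M h

lemma dyadicOuter_empty : dyadicOuter d ∅ = 0 :=
  le_antisymm (by simpa using dyadicOuter_le_tsum (A := (∅ : Set (UHS d))) ∅ (by simp)) bot_le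

lemma dyadicOuter_mono {A B : Set (UHS d)} (h : A ⊆ B) : dyadicOuter d A ≤ dyadicOuter d B :=
  le_iInf₂ fun M hM => dyadicOuter_le_tsum M (h.trans hM)

lemma dyadicOuter_dyadicBox_le (Q : ℤ × (Fin d → ℤ)) :
    dyadicOuter d (dyadicBox d Q.1 Q.2) ≤ dyadicVol d Q.1 := by
  simpa using dyadicOuter_le_tsum (A := dyadicBox d Q.1 Q.2) {Q} (by simp)

/-- A set is controlled from below by the bases of the Whitney regions that it meets. -/
lemma volume_le_dyadicOuter {O : Set (Fin d → ℝ)} {A : Set (UHS d)}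
    (h : ∀ y ∈ O, ∃ Q, y ∈ dyadicCube d Q ∧ (whitney d Q ∩ A).Nonempty) :
    volume O ≤ dyadicOuter d A := by
  refine le_iInf₂ fun M hM => ?_
  calc volume O ≤ volume (⋃ Q ∈ M, dyadicCube d Q) := by
        refine measure_mono fun y hy => ?_
        obtain ⟨Q, hyQ, q, hqQ, hqA⟩ := h y hy
        obtain ⟨R, hR, hqR⟩ := mem_iUnion₂.1 (hM hqA)
        exact mem_iUnion₂.2 ⟨R, hR, (dyadicCube_subset_of_whitney hqQ hqR).2 hyQ⟩
    _ ≤ ∑' Q : M, volume (dyadicCube d Q.1) := measure_biUnion_le _ (to_countable M) _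
    _ = _ := by simp only [volume_dyadicCube]

/-- A set of vanishing outer measure is empty, in any dimension. -/
lemma eq_empty_of_dyadicOuter_eq_zero {A : Set (UHS d)} (h : dyadicOuter d A = 0) : A = ∅ := by
  by_contra hne
  obtain ⟨q, hq⟩ := nonempty_iff_ne_empty.2 hne
  have hlow : ENNReal.ofReal q.2 ^ d ≤ dyadicOuter d A := by
    refine le_iInf₂ fun M hM => ?_
    obtain ⟨R, hR, hqR⟩ := mem_iUnion₂.1 (hM hq)
    refine le_trans ?_ (ENNReal.le_tsum (⟨R, hR⟩ : M))
    exact pow_le_pow_left₀ bot_le (ENNReal.ofReal_le_ofReal hqR.2.2.le) d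
  have hcov : dyadicOuter d A ≠ ∞ := by simp [h]
  have hpos : 0 < q.2 := by
    by_contra hq2
    apply hcov
    refine top_unique (le_iInf₂ fun M hM => ?_)
    obtain ⟨R, hR, hqR⟩ := mem_iUnion₂.1 (hM hq)
    exact absurd hqR.2.1 hq2
  rw [h] at hlow
  have := ENNReal.pow_pos (ENNReal.ofReal_pos.2 hpos) d
  exact absurd hlow (not_le.2 this)

/-- Covering by maximal boxes: if the cubes of the family `S` have at least half of their volume
in `O`, then the union of the boxes has outer measure at most twice the volume of `O`. -/
lemma dyadicOuter_biUnion_le (hd : d ≠ 0) {O : Set (Fin d → ℝ)} (hO : MeasurableSet O)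
    (S : Set (ℤ × (Fin d → ℤ)))
    (h : ∀ Q ∈ S, dyadicVol d Q.1 ≤ 2 * volume (dyadicCube d Q ∩ O)) :
    dyadicOuter d (⋃ Q ∈ S, dyadicBox d Q.1 Q.2) ≤ 2 * volume O := by
  rcases eq_or_ne (volume O) ∞ with hT | hT
  · simp [hT]
  obtain ⟨M, -, hM, hdom⟩ := exists_maximal_cubes hd (T := 2 * volume O)
    (ENNReal.mul_ne_top (by simp) hT) S fun M hMS hdisj => by
      calc ∑' Q : M, dyadicVol d Q.1.1 ≤ ∑' Q : M, 2 * volume (dyadicCube d Q.1 ∩ O) :=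
            ENNReal.tsum_le_tsum fun Q => h _ (hMS Q.2)
        _ = 2 * volume (⋃ Q ∈ M, dyadicCube d Q ∩ O) := by
            rw [ENNReal.tsum_mul_left, measure_biUnion (to_countable M)
              (hdisj.mono fun _ => inter_subset_left)
              fun Q _ => (measurableSet_dyadicCube Q).inter hO]
        _ ≤ 2 * volume O := by
            gcongr
            exact iUnion₂_subset fun _ _ => inter_subset_right
  refine (dyadicOuter_le_tsum M (iUnion₂_subset fun Q hQ => ?_)).trans hM
  obtain ⟨R, hR, hle, hsub⟩ := hdom Q hQ
  exact (dyadicBox_subset hle hsub).trans (subset_biUnion_of_mem (u := fun Q : ℤ × (Fin d → ℤ) =>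
    dyadicBox d Q.1 Q.2) hR)

end Geometry

section Auxiliary

variable {X : Type*} [MeasurableSpace X]

/-- Minkowski's inequality for countably many nonnegative functions. -/
lemma lintegral_tsum_rpow_le {ν : Measure X} {ρ : ℝ} (hρ : 1 ≤ ρ) {f : ℕ → X → ℝ≥0∞}
    (hf : ∀ n, Measurable (f n)) :
    (∫⁻ x, (∑' n, f n x) ^ ρ ∂ν) ^ ρ⁻¹ ≤ ∑' n, (∫⁻ x, f n x ^ ρ ∂ν) ^ ρ⁻¹ := by
  have hρ0 : 0 < ρ := by linarith
  have hfin : ∀ N : ℕ, (∫⁻ x, (∑ n ∈ Finset.range N, f n x) ^ ρ ∂ν) ^ ρ⁻¹ ≤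
      ∑ n ∈ Finset.range N, (∫⁻ x, f n x ^ ρ ∂ν) ^ ρ⁻¹ := by
    intro N
    induction N with
    | zero => simp [hρ0]
    | succ N ih =>
      simp only [Finset.sum_range_succ]
      have h := ENNReal.lintegral_Lp_add_le (μ := ν)
        (f := fun x => ∑ n ∈ Finset.range N, f n x) (g := f N)
        (Finset.measurable_fun_sum _ fun n _ => hf n).aemeasurable (hf N).aemeasurable hρ
      simp only [one_div, Pi.add_apply] at h
      exact h.trans (by gcongr)
  have hmono : Monotone fun (N : ℕ) x => (∑ n ∈ Finset.range N, f n x) ^ ρ := by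
    intro N M hNM x
    dsimp only
    gcongr
  have hsup : ∀ x, (∑' n, f n x) ^ ρ = ⨆ N : ℕ, (∑ n ∈ Finset.range N, f n x) ^ ρ := fun x => by
    rw [ENNReal.tsum_eq_iSup_nat]
    exact (ENNReal.orderIsoRpow ρ hρ0).map_iSup _
  simp_rw [hsup]
  rw [lintegral_iSup (fun N => (Finset.measurable_fun_sum _ fun n _ => hf n).pow_const ρ) hmono,
    ENNReal.rpow_inv_le_iff hρ0]
  refine iSup_le fun N => ?_
  rw [← ENNReal.rpow_inv_le_iff hρ0]
  exact (hfin N).trans (ENNReal.sum_le_tsum _)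

lemma tsum_rpow_le_tsum {ι : Type*} {q : ℝ} (hq : 0 < q) (hq1 : q ≤ 1) (a : ι → ℝ≥0∞) :
    (∑' i, a i) ^ q ≤ ∑' i, a i ^ q := by
  classical
  rw [ENNReal.tsum_eq_iSup_sum]
  refine ((ENNReal.orderIsoRpow q hq).map_iSup _).le.trans (iSup_le fun s => ?_)
  refine le_trans ?_ (ENNReal.sum_le_tsum s)
  simp only [ENNReal.orderIsoRpow_apply]
  induction s using Finset.induction_on with
  | empty => simp [hq]
  | insert i s hi ih =>
    rw [Finset.sum_insert hi, Finset.sum_insert hi]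
    exact (ENNReal.rpow_add_le_add_rpow _ _ hq.le hq1).trans (by gcongr)

lemma two_zpow_ne_zero (k : ℤ) : (2:ℝ≥0∞) ^ k ≠ 0 :=
  (ENNReal.zpow_pos (by simp) (by simp) k).ne'

lemma two_zpow_ne_top (k : ℤ) : (2:ℝ≥0∞) ^ k ≠ ∞ :=
  ENNReal.zpow_ne_top (by simp) (by simp) k

lemma two_zpow_eq_ofReal (k : ℤ) : (2:ℝ≥0∞) ^ k = ENNReal.ofReal ((2:ℝ) ^ k) := by
  rw [← Real.rpow_intCast, ← ENNReal.ofReal_rpow_of_pos (by norm_num), ENNReal.rpow_intCast]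
  simp

/-- Dyadic layer cake bound for a single value. -/
lemma rpow_le_tsum_zpow {p : ℝ} (hp : 0 < p) (y : ℝ≥0∞) :
    y ^ p ≤ 2 ^ p * ∑' m : ℤ, ((2:ℝ≥0∞) ^ m) ^ p * (Ioi ((2:ℝ≥0∞) ^ m)).indicator 1 y := by
  rcases eq_or_ne y 0 with rfl | h0
  · simp [hp]
  rcases eq_or_ne y ∞ with rfl | ht
  · have : ∑' m : ℤ, ((2:ℝ≥0∞) ^ m) ^ p * (Ioi ((2:ℝ≥0∞) ^ m)).indicator 1 (∞ : ℝ≥0∞) = ∞ := by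
      refine top_unique ?_
      calc (∞ : ℝ≥0∞) = ∑' _ : ℕ, (1:ℝ≥0∞) := (ENNReal.tsum_const_eq_top_of_ne_zero (by simp)).symm
        _ ≤ ∑' n : ℕ, ((2:ℝ≥0∞) ^ (n:ℤ)) ^ p *
              (Ioi ((2:ℝ≥0∞) ^ (n:ℤ))).indicator 1 (∞ : ℝ≥0∞) := by
            refine ENNReal.tsum_le_tsum fun n => ?_
            have hmem : (∞ : ℝ≥0∞) ∈ Ioi ((2:ℝ≥0∞) ^ (n:ℤ)) := (two_zpow_ne_top _).lt_top
            rw [indicator_of_mem hmem, Pi.one_apply, mul_one, zpow_natCast]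
            exact ENNReal.one_le_rpow (one_le_pow₀ (by norm_num)) hp
        _ ≤ _ := ENNReal.tsum_comp_le_tsum_of_injective Nat.cast_injective
              (fun m : ℤ => ((2:ℝ≥0∞) ^ m) ^ p * (Ioi ((2:ℝ≥0∞) ^ m)).indicator 1 (∞ : ℝ≥0∞))
    rw [this, ENNReal.mul_top]
    · simp
    · simp
  · obtain ⟨m, hm1, hm2⟩ := ENNReal.exists_mem_Ioc_zpow h0 ht (y := 2) (by norm_num) (by simp)
    calc y ^ p ≤ (2 * 2 ^ m) ^ p := by
          gcongr
          rwa [ENNReal.zpow_add (by simp) (by simp), zpow_one, mul_comm] at hm2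
      _ = 2 ^ p * (((2:ℝ≥0∞) ^ m) ^ p * (Ioi ((2:ℝ≥0∞) ^ m)).indicator 1 y) := by
          rw [indicator_of_mem (by exact hm1), ENNReal.mul_rpow_of_nonneg _ _ hp.le]; simp
      _ ≤ _ := by
          gcongr
          exact ENNReal.le_tsum
            (f := fun m : ℤ => ((2:ℝ≥0∞) ^ m) ^ p * (Ioi ((2:ℝ≥0∞) ^ m)).indicator 1 y) m

lemma lintegral_rpow_le_tsum_measure {ν : Measure X} {p : ℝ} (hp : 0 < p) {g : X → ℝ≥0∞}
    (hg : Measurable g) :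
    ∫⁻ x, g x ^ p ∂ν ≤ 2 ^ p * ∑' m : ℤ, ((2:ℝ≥0∞) ^ m) ^ p * ν {x | 2 ^ m < g x} := by
  have hmeas : ∀ m : ℤ, MeasurableSet {x | 2 ^ m < g x} := fun m =>
    measurableSet_lt measurable_const hg
  calc ∫⁻ x, g x ^ p ∂ν
      ≤ ∫⁻ x, 2 ^ p * ∑' m : ℤ, ((2:ℝ≥0∞) ^ m) ^ p * {x | 2 ^ m < g x}.indicator 1 x ∂ν :=
        lintegral_mono fun x => rpow_le_tsum_zpow hp (g x)
    _ = _ := by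
        have h1 : ∀ m : ℤ, Measurable ({x | 2 ^ m < g x}.indicator (1 : X → ℝ≥0∞)) :=
          fun m => measurable_one.indicator (hmeas m)
        rw [lintegral_const_mul _ (Measurable.tsum fun m => (h1 m).const_mul _),
          lintegral_tsum fun m => ((h1 m).const_mul _).aemeasurable]
        congr 2 with m
        rw [lintegral_const_mul _ (h1 m), lintegral_indicator_one (hmeas m)]

/-- Layer cake bound for extended nonnegative functions. -/
lemma lintegral_measure_lt_le {ν : Measure X} {p : ℝ} (hp : 0 < p) {g : X → ℝ≥0∞}
    (hg : Measurable g) :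
    ∫⁻ l in Ioi (0:ℝ), ENNReal.ofReal (p * l ^ (p - 1)) * ν {x | ENNReal.ofReal l < g x} ≤
      ∫⁻ x, g x ^ p ∂ν := by
  rcases eq_or_ne (∫⁻ x, g x ^ p ∂ν) ∞ with h | h
  · simp [h]
  have hfin : ∀ᵐ x ∂ν, g x < ∞ := by
    filter_upwards [ae_lt_top (hg.pow_const p) h] with x hx
    contrapose! hx
    rw [top_le_iff.1 hx, ENNReal.top_rpow_of_pos hp]
  have h1 := lintegral_rpow_eq_lintegral_meas_lt_mul ν (f := fun x => (g x).toReal)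
    (ae_of_all _ fun x => ENNReal.toReal_nonneg) hg.ennreal_toReal.aemeasurable hp
  have h2 : ∫⁻ x, ENNReal.ofReal ((g x).toReal ^ p) ∂ν = ∫⁻ x, g x ^ p ∂ν := by
    refine lintegral_congr_ae ?_
    filter_upwards [hfin] with x hx
    rw [← ENNReal.ofReal_rpow_of_nonneg ENNReal.toReal_nonneg hp.le, ENNReal.ofReal_toReal hx.ne]
  rw [← h2, h1, ← lintegral_const_mul' _ _ (by simp)]
  refine le_of_eq (setLIntegral_congr_fun measurableSet_Ioi fun l hl => ?_)
  have h3 : ν {x | ENNReal.ofReal l < g x} = ν {x | l < (g x).toReal} := by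
    refine measure_congr ?_
    filter_upwards [hfin] with x hx
    exact propext (ENNReal.ofReal_lt_iff_lt_toReal (le_of_lt hl) hx.ne)
  simp only [h3]
  rw [ENNReal.ofReal_mul hp.le, mul_assoc, mul_comm (ENNReal.ofReal (l ^ _))]

/-- Summing the dyadic values of a decreasing function. -/
lemma tsum_zpow_le_lintegral {p : ℝ} (hp : 1 ≤ p) {s : ℝ≥0∞ → ℝ≥0∞} (hs : Antitone s) :
    ∑' k : ℤ, ((2:ℝ≥0∞) ^ k) ^ p * s (2 ^ k) ≤
      2 ^ p * ∫⁻ l in Ioi (0:ℝ), ENNReal.ofReal (p * l ^ (p - 1)) * s (ENNReal.ofReal l) := by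
  have hp0 : 0 < p := by linarith
  have hdisj : Pairwise (Function.onFun Disjoint fun k : ℤ => Ioc ((2:ℝ) ^ k) (2 ^ (k + 1))) :=
    (zpow_right_mono₀ (one_le_two : (1:ℝ) ≤ 2)).pairwise_disjoint_on_Ioc_succ
  calc ∑' k : ℤ, ((2:ℝ≥0∞) ^ k) ^ p * s (2 ^ k)
      = ∑' k : ℤ, ((2:ℝ≥0∞) ^ (k + 1)) ^ p * s (2 ^ (k + 1)) :=
        ((Equiv.addRight (1:ℤ)).tsum_eq fun k : ℤ => ((2:ℝ≥0∞) ^ k) ^ p * s (2 ^ k)).symm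
    _ ≤ ∑' k : ℤ, 2 ^ p * ∫⁻ l in Ioc ((2:ℝ) ^ k) (2 ^ (k + 1)),
          ENNReal.ofReal (p * l ^ (p - 1)) * s (ENNReal.ofReal l) := by
        refine ENNReal.tsum_le_tsum fun k => ?_
        have hk : (0:ℝ) < 2 ^ k := by positivity
        have hlow : ENNReal.ofReal (((2:ℝ) ^ k) ^ (p - 1)) * s (2 ^ (k + 1)) *
            ENNReal.ofReal (2 ^ k) ≤ ∫⁻ l in Ioc ((2:ℝ) ^ k) (2 ^ (k + 1)),
            ENNReal.ofReal (p * l ^ (p - 1)) * s (ENNReal.ofReal l) := by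
          have hvol : volume (Ioc ((2:ℝ) ^ k) (2 ^ (k + 1))) = ENNReal.ofReal (2 ^ k) := by
            rw [Real.volume_Ioc, zpow_add₀ (by norm_num)]
            congr 1; ring
          rw [← hvol, ← setLIntegral_const]
          refine setLIntegral_mono' measurableSet_Ioc fun l hl => ?_
          have hl0 : 0 < l := hk.trans hl.1
          gcongr
          · calc ((2:ℝ) ^ k) ^ (p - 1) ≤ l ^ (p - 1) :=
                  Real.rpow_le_rpow hk.le hl.1.le (by linarith)
              _ ≤ p * l ^ (p - 1) := le_mul_of_one_le_left (by positivity) hp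
          · apply hs
            rw [two_zpow_eq_ofReal]
            exact ENNReal.ofReal_le_ofReal hl.2
        refine le_trans (le_of_eq ?_) (mul_le_mul_right hlow _)
        have e1 : ENNReal.ofReal (((2:ℝ) ^ k) ^ (p - 1)) * ENNReal.ofReal (2 ^ k) =
            ((2:ℝ≥0∞) ^ k) ^ p := by
          rw [← ENNReal.ofReal_mul (by positivity), two_zpow_eq_ofReal,
            ENNReal.ofReal_rpow_of_pos hk]
          congr 1
          nth_rw 2 [← Real.rpow_one ((2:ℝ) ^ k)]
          rw [← Real.rpow_add hk]; congr 1; ring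
        rw [mul_right_comm, e1, ENNReal.zpow_add (by simp) (by simp), zpow_one,
          ENNReal.mul_rpow_of_nonneg _ _ hp0.le]
        ring
    _ = 2 ^ p * ∫⁻ l in ⋃ k : ℤ, Ioc ((2:ℝ) ^ k) (2 ^ (k + 1)),
          ENNReal.ofReal (p * l ^ (p - 1)) * s (ENNReal.ofReal l) := by
        rw [ENNReal.tsum_mul_left, lintegral_iUnion (fun _ => measurableSet_Ioc) hdisj]
    _ ≤ _ := by
        gcongr
        exact iUnion_subset fun k l hl => lt_trans (by positivity : (0:ℝ) < 2 ^ k) hl.1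

lemma essSup_tsum_le {ν : Measure X} (f : ℕ → X → ℝ≥0∞) :
    essSup (fun x => ∑' n, f n x) ν ≤ ∑' n, essSup (f n) ν := by
  refine essSup_le_of_ae_le _ ?_
  filter_upwards [ae_all_iff.2 fun n => ENNReal.ae_le_essSup (μ := ν) (f n)] with x hx
  exact ENNReal.tsum_le_tsum hx

end Auxiliary

section Outer

variable {X : Type*} [MeasurableSpace X] {μ : Set X → ℝ≥0∞} {ν : Measure X} {r : ℝ≥0∞}

lemma toReal_one_le (hr : 1 ≤ r) (hr' : r ≠ ∞) : 1 ≤ r.toReal := by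
  simpa using ENNReal.toReal_mono hr' hr

lemma ellSize_mono_fun {f g : X → ℝ≥0∞} (h : ∀ x, f x ≤ g x) (A : Set X) :
    ellSize μ ν r f A ≤ ellSize μ ν r g A := by
  unfold ellSize
  split_ifs
  · exact essSup_mono_ae (ae_of_all _ h)
  · gcongr with x
    exact h x

lemma outerSup_mono_fun {f g : X → ℝ≥0∞} (h : ∀ x, f x ≤ g x) :
    outerSup μ ν r f ≤ outerSup μ ν r g :=
  iSup₂_mono fun A _ => ellSize_mono_fun h A

/-- The sizes satisfy the triangle inequality. -/
lemma outerSup_tsum_le (hr : 1 ≤ r) {f : ℕ → X → ℝ≥0∞} (hf : ∀ n, Measurable (f n)) :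
    outerSup μ ν r (fun x => ∑' n, f n x) ≤ ∑' n, outerSup μ ν r (f n) := by
  refine iSup₂_le fun A hA => ?_
  refine le_trans ?_ (ENNReal.tsum_le_tsum fun n => le_iSup₂ (f := fun (A : Set X)
    (_ : MeasurableSet A) => ellSize μ ν r (f n) A) A hA)
  unfold ellSize
  split_ifs with h
  · exact essSup_tsum_le f
  · have hρ := toReal_one_le hr h
    have hinv : 0 ≤ r.toReal⁻¹ := by positivity
    simp_rw [ENNReal.mul_rpow_of_nonneg _ _ hinv, ENNReal.tsum_mul_left]
    gcongr
    exact lintegral_tsum_rpow_le hρ hf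

lemma superLevel_antitone (f : X → ℝ≥0∞) : Antitone (superLevel μ ν r f) :=
  fun _ _ h => le_iInf fun A => le_iInf fun hA => le_iInf fun hle =>
    iInf_le_of_le A (iInf_le_of_le hA (iInf_le_of_le (hle.trans h) le_rfl))

lemma superLevel_le {f : X → ℝ≥0∞} {l : ℝ≥0∞} {A : Set X} (hA : MeasurableSet A)
    (h : outerSup μ ν r (Aᶜ.indicator f) ≤ l) : superLevel μ ν r f l ≤ μ A :=
  iInf_le_of_le A (iInf_le_of_le hA (iInf_le_of_le h le_rfl))

lemma exists_of_superLevel_lt {f : X → ℝ≥0∞} {l K : ℝ≥0∞} (h : superLevel μ ν r f l < K) :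
    ∃ A, MeasurableSet A ∧ outerSup μ ν r (Aᶜ.indicator f) ≤ l ∧ μ A < K := by
  simp only [superLevel, iInf_lt_iff] at h
  obtain ⟨A, hA, h1, h2⟩ := h
  exact ⟨A, hA, h1, h2⟩

/-- Nearly optimal level sets at all dyadic levels. -/
lemma exists_level_sets {f : X → ℝ≥0∞} {p : ℝ} (hp : 0 ≤ p) {K : ℝ≥0∞}
    (h : ∑' k : ℤ, ((2:ℝ≥0∞) ^ k) ^ p * superLevel μ ν r f (2 ^ k) < K) :
    ∃ A : ℤ → Set X, (∀ k, MeasurableSet (A k)) ∧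
      (∀ k, outerSup μ ν r ((A k)ᶜ.indicator f) ≤ 2 ^ k) ∧
      ∑' k : ℤ, ((2:ℝ≥0∞) ^ k) ^ p * μ (A k) ≤ K := by
  obtain ⟨ε, hε, hsum⟩ := ENNReal.exists_pos_sum_of_countable (tsub_pos_of_lt h).ne' ℤ
  have hw0 : ∀ k : ℤ, ((2:ℝ≥0∞) ^ k) ^ p ≠ 0 := fun k =>
    (ENNReal.rpow_pos (two_zpow_ne_zero k).bot_lt (two_zpow_ne_top k)).ne'
  have hwt : ∀ k : ℤ, ((2:ℝ≥0∞) ^ k) ^ p ≠ ∞ := fun k =>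
    ENNReal.rpow_ne_top_of_nonneg hp (two_zpow_ne_top k)
  have hfin : ∀ k : ℤ, superLevel μ ν r f (2 ^ k) ≠ ∞ := fun k hk => by
    have h1 := (ENNReal.le_tsum (f := fun k : ℤ => ((2:ℝ≥0∞) ^ k) ^ p *
      superLevel μ ν r f (2 ^ k)) k).trans_lt h
    simp [hk, ENNReal.mul_top (hw0 k)] at h1
  have hex : ∀ k : ℤ, ∃ A, MeasurableSet A ∧ outerSup μ ν r (Aᶜ.indicator f) ≤ 2 ^ k ∧
      μ A < superLevel μ ν r f (2 ^ k) + ε k / ((2:ℝ≥0∞) ^ k) ^ p := fun k =>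
    exists_of_superLevel_lt (ENNReal.lt_add_right (hfin k)
      (ENNReal.div_pos (by simpa using (hε k).ne') (hwt k)).ne')
  choose A hA h1 h2 using hex
  refine ⟨A, hA, h1, ?_⟩
  calc ∑' k : ℤ, ((2:ℝ≥0∞) ^ k) ^ p * μ (A k)
      ≤ ∑' k : ℤ, (((2:ℝ≥0∞) ^ k) ^ p * superLevel μ ν r f (2 ^ k) + ε k) := by
        refine ENNReal.tsum_le_tsum fun k => ?_
        refine (mul_le_mul_right (h2 k).le _).trans ?_
        rw [mul_add, ENNReal.mul_div_cancel (hw0 k) (hwt k)]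
    _ = ∑' k : ℤ, ((2:ℝ≥0∞) ^ k) ^ p * superLevel μ ν r f (2 ^ k) + ∑' k, (ε k : ℝ≥0∞) :=
        ENNReal.tsum_add
    _ ≤ _ + (K - _) := add_le_add le_rfl hsum.le
    _ = K := add_tsub_cancel_of_le h.le

lemma outerSup_top_le_iff {f : X → ℝ≥0∞} {l : ℝ≥0∞} :
    outerSup μ ν ∞ f ≤ l ↔ ∀ᵐ x ∂ν, f x ≤ l := by
  simp only [outerSup, ellSize, if_true, iSup_le_iff]
  constructor
  · intro h
    have := h univ MeasurableSet.univ
    rw [Measure.restrict_univ] at this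
    filter_upwards [ENNReal.ae_le_essSup (μ := ν) f] with x hx using hx.trans this
  · exact fun h A _ => essSup_le_of_ae_le _ (ae_restrict_of_ae h)

end Outer

section HalfSpace

variable {d : ℕ} {r : ℝ≥0∞}

/-- The size is controlled by its values on dyadic boxes. -/
lemma outerSup_le_of_dyadicBox (hr : 1 ≤ r) (hr' : r ≠ ∞) {g : UHS d → ℝ≥0∞} {l : ℝ≥0∞}
    (hl0 : l ≠ 0) (hl : l ≠ ∞)
    (h : ∀ Q : ℤ × (Fin d → ℤ), ∫⁻ q in dyadicBox d Q.1 Q.2, g q ^ r.toReal ∂uhsMeasure d ≤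
      l ^ r.toReal * dyadicVol d Q.1) :
    outerSup (dyadicOuter d) (uhsMeasure d) r g ≤ l := by
  have hρ := toReal_one_le hr hr'
  have hρ0 : 0 < r.toReal := by linarith
  have hc0 : l ^ r.toReal ≠ 0 := (ENNReal.rpow_pos hl0.bot_lt hl).ne'
  have hct : l ^ r.toReal ≠ ∞ := ENNReal.rpow_ne_top_of_nonneg hρ0.le hl
  refine iSup₂_le fun A hA => ?_
  rw [ellSize, if_neg hr', ENNReal.rpow_inv_le_iff hρ0]
  rcases eq_or_ne (dyadicOuter d A) 0 with h0 | h0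
  · simp [eq_empty_of_dyadicOuter_eq_zero h0]
  rcases eq_or_ne (dyadicOuter d A) ∞ with ht | ht
  · simp [ht]
  rw [mul_comm, ← div_eq_mul_inv, ENNReal.div_le_iff h0 ht, mul_comm,
    ← ENNReal.div_le_iff hc0 hct]
  refine le_iInf₂ fun M hM => ?_
  rw [ENNReal.div_le_iff hc0 hct, ← ENNReal.tsum_mul_right]
  calc ∫⁻ q in A, g q ^ r.toReal ∂uhsMeasure d
      ≤ ∫⁻ q in ⋃ Q : M, dyadicBox d Q.1.1 Q.1.2, g q ^ r.toReal ∂uhsMeasure d :=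
        lintegral_mono_set (by rwa [iUnion_subtype])
    _ ≤ ∑' Q : M, ∫⁻ q in dyadicBox d Q.1.1 Q.1.2, g q ^ r.toReal ∂uhsMeasure d :=
        lintegral_iUnion_le _ _
    _ ≤ _ := ENNReal.tsum_le_tsum fun Q => (h Q).trans (mul_comm _ _).le

lemma setLIntegral_le_of_outerSup_le (hr : 1 ≤ r) (hr' : r ≠ ∞) {g : UHS d → ℝ≥0∞} {l : ℝ≥0∞}
    (h : outerSup (dyadicOuter d) (uhsMeasure d) r g ≤ l) {A : Set (UHS d)}
    (hA : MeasurableSet A) (hAt : dyadicOuter d A ≠ ∞) :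
    ∫⁻ q in A, g q ^ r.toReal ∂uhsMeasure d ≤ l ^ r.toReal * dyadicOuter d A := by
  have hρ0 : 0 < r.toReal := by linarith [toReal_one_le hr hr']
  rcases eq_or_ne (dyadicOuter d A) 0 with h0 | h0
  · simp [eq_empty_of_dyadicOuter_eq_zero h0]
  have h1 : ellSize (dyadicOuter d) (uhsMeasure d) r g A ≤ l := (le_iSup₂ (f := fun (A : Set _)
    (_ : MeasurableSet A) => ellSize (dyadicOuter d) (uhsMeasure d) r g A) A hA).trans h
  rwa [ellSize, if_neg hr', ENNReal.rpow_inv_le_iff hρ0, mul_comm, ← div_eq_mul_inv,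
    ENNReal.div_le_iff h0 hAt] at h1

lemma setLIntegral_dyadicBox_le (hr : 1 ≤ r) (hr' : r ≠ ∞) {g : UHS d → ℝ≥0∞} {l : ℝ≥0∞}
    (h : outerSup (dyadicOuter d) (uhsMeasure d) r g ≤ l) (Q : ℤ × (Fin d → ℤ)) :
    ∫⁻ q in dyadicBox d Q.1 Q.2, g q ^ r.toReal ∂uhsMeasure d ≤
      l ^ r.toReal * dyadicVol d Q.1 := by
  have hle := dyadicOuter_dyadicBox_le Q
  refine (setLIntegral_le_of_outerSup_le hr hr' h (measurableSet_dyadicBox Q)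
    (ne_top_of_le_ne_top (dyadicVol_ne_top _) hle)).trans ?_
  gcongr

lemma setLIntegral_indicator_compl {ρ : ℝ} (hρ : 0 < ρ) (f : UHS d → ℝ≥0∞) {A B : Set (UHS d)}
    (hA : MeasurableSet A) :
    ∫⁻ q in B, Aᶜ.indicator f q ^ ρ ∂uhsMeasure d = ∫⁻ q in B \ A, f q ^ ρ ∂uhsMeasure d := by
  have : ∀ q, Aᶜ.indicator f q ^ ρ = Aᶜ.indicator (fun q => f q ^ ρ) q := fun q => by
    by_cases hq : q ∈ A <;> simp [hq, hρ]
  simp_rw [this]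
  rw [setLIntegral_indicator hA.compl, sdiff_eq, inter_comm]

/-- Reduction of the quasi-triangle inequality to a sublinear functional that is comparable to
the super level measures. -/
lemma outerLp_tsum_le_of_functional {p : ℝ≥0∞} (hp : 1 ≤ p) (hp' : p ≠ ∞)
    (Φ : (UHS d → ℝ≥0∞) → (Fin d → ℝ) → ℝ≥0∞)
    (hmeas : ∀ f, Measurable (Φ f))
    (hsub : ∀ f : ℕ → UHS d → ℝ≥0∞, (∀ n, Measurable (f n)) →
      ∀ y, Φ (fun q => ∑' n, f n q) y ≤ ∑' n, Φ (f n) y)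
    (hup : ∀ f, Measurable f → ∀ l : ℝ≥0∞, l ≠ 0 → l ≠ ∞ →
      superLevel (dyadicOuter d) (uhsMeasure d) r f (2 * l) ≤ 2 * volume {y | l < Φ f y})
    {K : ℝ≥0∞} (hK : K ≠ ∞)
    (hlow : ∀ f, Measurable f → ∀ A : ℤ → Set (UHS d), (∀ k, MeasurableSet (A k)) →
      (∀ k, outerSup (dyadicOuter d) (uhsMeasure d) r ((A k)ᶜ.indicator f) ≤ 2 ^ k) →
      ∑' k : ℤ, ((2:ℝ≥0∞) ^ k) ^ p.toReal * dyadicOuter d (A k) ≠ ∞ →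
      ∫⁻ y, Φ f y ^ p.toReal ≤
        K * ∑' k : ℤ, ((2:ℝ≥0∞) ^ k) ^ p.toReal * dyadicOuter d (A k)) :
    ∃ C : ℝ≥0∞, 0 < C ∧ C ≠ ∞ ∧
      ∀ f : ℕ → UHS d → ℝ≥0∞, (∀ n, Measurable (f n)) →
        outerLp (dyadicOuter d) (uhsMeasure d) p r (fun q => ∑' n, f n q) ≤
          C * ∑' n, outerLp (dyadicOuter d) (uhsMeasure d) p r (f n) := by
  set P := p.toReal with hP
  have hP1 : 1 ≤ P := toReal_one_le hp hp'
  have hP0 : 0 < P := by linarith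
  have hPi : 0 ≤ P⁻¹ := by positivity
  let I : (UHS d → ℝ≥0∞) → ℝ≥0∞ := fun f => ∫⁻ l in Ioi (0:ℝ), ENNReal.ofReal (P * l ^ (P - 1)) *
    superLevel (dyadicOuter d) (uhsMeasure d) r f (ENNReal.ofReal l)
  have hI : ∀ f, outerLp (dyadicOuter d) (uhsMeasure d) p r f = I f ^ P⁻¹ := fun f => by
    rw [outerLp, if_neg hp']
  have hupper : ∀ f, Measurable f → I f ≤ 2 * 2 ^ P * ∫⁻ y, Φ f y ^ P := by
    intro f hf
    calc I f ≤ ∫⁻ l in Ioi (0:ℝ), 2 * (ENNReal.ofReal (P * l ^ (P - 1)) *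
          volume {y | ENNReal.ofReal l < 2 * Φ f y}) := by
          refine setLIntegral_mono' measurableSet_Ioi fun l hl => ?_
          have hl2 : ENNReal.ofReal l = 2 * (ENNReal.ofReal l / 2) :=
            (ENNReal.mul_div_cancel (by simp) (by simp)).symm
          rw [mul_left_comm]
          gcongr
          have hset : {y | ENNReal.ofReal l < 2 * Φ f y} = {y | ENNReal.ofReal l / 2 < Φ f y} := by
            ext y
            simp only [mem_ofPred_eq]
            rw [ENNReal.div_lt_iff (by simp) (by simp), mul_comm]
          rw [hset]
          conv_lhs => rw [hl2]
          refine hup f hf _ ?_ ?_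
          · simpa using hl
          · exact ENNReal.div_ne_top (by simp) (by simp)
      _ = 2 * ∫⁻ l in Ioi (0:ℝ), ENNReal.ofReal (P * l ^ (P - 1)) *
          volume {y | ENNReal.ofReal l < 2 * Φ f y} := lintegral_const_mul' _ _ (by simp)
      _ ≤ 2 * ∫⁻ y, (2 * Φ f y) ^ P := by
          gcongr
          exact lintegral_measure_lt_le hP0 ((hmeas f).const_mul 2)
      _ = _ := by
          simp_rw [ENNReal.mul_rpow_of_nonneg _ _ hP0.le]
          rw [lintegral_const_mul' _ _ (by simp), mul_assoc]
  have hlower : ∀ f, Measurable f → ∫⁻ y, Φ f y ^ P ≤ (K + 1) * (2 ^ P * I f) := by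
    intro f hf
    have hK0 : K + 1 ≠ 0 := by simp
    have hKt : K + 1 ≠ ∞ := by simp [hK]
    rw [mul_comm, ← ENNReal.div_le_iff hK0 hKt]
    refine le_trans ?_ (tsum_zpow_le_lintegral hP1 (superLevel_antitone f))
    refine le_of_forall_gt_imp_ge_of_dense fun T hT => ?_
    rcases eq_or_ne T ∞ with rfl | hTt
    · exact le_top
    obtain ⟨A, hA, h1, h2⟩ := exists_level_sets hP0.le hT
    rw [ENNReal.div_le_iff hK0 hKt]
    refine (hlow f hf A hA h1 (ne_top_of_le_ne_top hTt h2)).trans ?_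
    rw [mul_comm]
    gcongr
    exact le_self_add
  have hcle : ∀ f : ℕ → UHS d → ℝ≥0∞, (∀ n, Measurable (f n)) →
      (∫⁻ y, Φ (fun q => ∑' n, f n q) y ^ P) ^ P⁻¹ ≤ ∑' n, (∫⁻ y, Φ (f n) y ^ P) ^ P⁻¹ :=
    fun f hf => le_trans (by gcongr with y; exact hsub f hf y)
      (lintegral_tsum_rpow_le hP1 fun n => hmeas (f n))
  refine ⟨(2 * 2 ^ P) ^ P⁻¹ * ((K + 1) * 2 ^ P) ^ P⁻¹, ?_, ?_, fun f hf => ?_⟩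
  · refine ENNReal.mul_pos (ENNReal.rpow_pos ?_ ?_).ne' (ENNReal.rpow_pos ?_ ?_).ne'
    · exact ENNReal.mul_pos (by simp) (by simp)
    · exact ENNReal.mul_ne_top (by simp) (by simp)
    · exact ENNReal.mul_pos (by simp) (by simp)
    · exact ENNReal.mul_ne_top (by simp [hK]) (by simp)
  · refine ENNReal.mul_ne_top (ENNReal.rpow_ne_top_of_nonneg hPi ?_)
      (ENNReal.rpow_ne_top_of_nonneg hPi ?_)
    · exact ENNReal.mul_ne_top (by simp) (by simp)
    · exact ENNReal.mul_ne_top (by simp [hK]) (by simp)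
  · simp_rw [hI]
    calc I (fun q => ∑' n, f n q) ^ P⁻¹
        ≤ (2 * 2 ^ P * ∫⁻ y, Φ (fun q => ∑' n, f n q) y ^ P) ^ P⁻¹ := by
          gcongr
          exact hupper _ (Measurable.tsum hf)
      _ = (2 * 2 ^ P) ^ P⁻¹ * (∫⁻ y, Φ (fun q => ∑' n, f n q) y ^ P) ^ P⁻¹ :=
          ENNReal.mul_rpow_of_nonneg _ _ hPi
      _ ≤ (2 * 2 ^ P) ^ P⁻¹ * ∑' n, ((K + 1) * 2 ^ P) ^ P⁻¹ * I (f n) ^ P⁻¹ := by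
          gcongr
          refine (hcle f hf).trans (ENNReal.tsum_le_tsum fun n => ?_)
          rw [← ENNReal.mul_rpow_of_nonneg _ _ hPi]
          gcongr
          rw [mul_assoc]
          exact hlower (f n) (hf n)
      _ = _ := by rw [ENNReal.tsum_mul_left, mul_assoc]

section LevelSets

variable {f : UHS d → ℝ≥0∞} {A : ℤ → Set (UHS d)} {p : ℝ}

lemma dyadicOuter_ne_top_of_tsum
    (hsum : ∑' k : ℤ, ((2:ℝ≥0∞) ^ k) ^ p * dyadicOuter d (A k) ≠ ∞) (k : ℤ) :
    dyadicOuter d (A k) ≠ ∞ := by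
  intro hk
  have h := ENNReal.ne_top_of_tsum_ne_top hsum k
  rw [hk, ENNReal.mul_top (ENNReal.rpow_pos (two_zpow_ne_zero k).bot_lt (two_zpow_ne_top k)).ne']
    at h
  exact h rfl

lemma subset_iUnion_diff_of_tsum (hp : 0 < p)
    (hsum : ∑' k : ℤ, ((2:ℝ≥0∞) ^ k) ^ p * dyadicOuter d (A k) ≠ ∞) (m : ℤ) :
    A m ⊆ ⋃ n : ℕ, A (m + n) \ A (m + n + 1) := by
  intro q hq
  by_contra hnot
  simp only [mem_iUnion, not_exists, mem_sdiff, not_and, not_not] at hnot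
  have hall : ∀ n : ℕ, q ∈ A (m + n) := by
    intro n
    induction n with
    | zero => simpa using hq
    | succ n ih => simpa [add_assoc] using hnot n ih
  have hpos : dyadicOuter d {q} ≠ 0 := fun h0 =>
    (singleton_ne_empty q) (eq_empty_of_dyadicOuter_eq_zero h0)
  have hc : ((2:ℝ≥0∞) ^ m) ^ p * dyadicOuter d {q} ≠ 0 :=
    mul_ne_zero (ENNReal.rpow_pos (two_zpow_ne_zero m).bot_lt (two_zpow_ne_top m)).ne' hpos
  apply hsum
  refine top_unique ?_
  calc (∞ : ℝ≥0∞) = ∑' _ : ℕ, ((2:ℝ≥0∞) ^ m) ^ p * dyadicOuter d {q} :=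
        (ENNReal.tsum_const_eq_top_of_ne_zero hc).symm
    _ ≤ ∑' n : ℕ, ((2:ℝ≥0∞) ^ (m + n)) ^ p * dyadicOuter d (A (m + n)) := by
        refine ENNReal.tsum_le_tsum fun n => ?_
        gcongr
        · norm_num
        · omega
        · exact dyadicOuter_mono (singleton_subset_iff.2 (hall n))
    _ ≤ _ := ENNReal.tsum_comp_le_tsum_of_injective
        (f := fun n : ℕ => m + (n:ℤ)) (fun a b h => by simpa using h)
        (fun k : ℤ => ((2:ℝ≥0∞) ^ k) ^ p * dyadicOuter d (A k))

lemma setLIntegral_diff_le (hr : 1 ≤ r) (hr' : r ≠ ∞) (hA : ∀ k, MeasurableSet (A k))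
    (hsize : ∀ k, outerSup (dyadicOuter d) (uhsMeasure d) r ((A k)ᶜ.indicator f) ≤ 2 ^ k)
    (hsum : ∑' k : ℤ, ((2:ℝ≥0∞) ^ k) ^ p * dyadicOuter d (A k) ≠ ∞) (k : ℤ) :
    ∫⁻ q in A k \ A (k + 1), f q ^ r.toReal ∂uhsMeasure d ≤
      ((2:ℝ≥0∞) ^ (k + 1)) ^ r.toReal * dyadicOuter d (A k) := by
  rw [← setLIntegral_indicator_compl (by linarith [toReal_one_le hr hr']) f (hA (k + 1))]
  exact setLIntegral_le_of_outerSup_le hr hr' (hsize (k + 1)) (hA k)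
    (dyadicOuter_ne_top_of_tsum hsum k)

lemma setLIntegral_whitney_le_tsum (hr : 1 ≤ r) (hr' : r ≠ ∞) (hA : ∀ k, MeasurableSet (A k))
    (hsize : ∀ k, outerSup (dyadicOuter d) (uhsMeasure d) r ((A k)ᶜ.indicator f) ≤ 2 ^ k)
    (hp : 0 < p) (hsum : ∑' k : ℤ, ((2:ℝ≥0∞) ^ k) ^ p * dyadicOuter d (A k) ≠ ∞)
    (Q : ℤ × (Fin d → ℤ)) :
    ∫⁻ q in whitney d Q, f q ^ r.toReal ∂uhsMeasure d ≤
      ∑' k : ℤ, ∫⁻ q in whitney d Q ∩ (A k \ A (k + 1)), f q ^ r.toReal ∂uhsMeasure d := by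
  have hρ0 : 0 < r.toReal := by linarith [toReal_one_le hr hr']
  have hcov : whitney d Q ⊆
      (⋃ k, whitney d Q ∩ (A k \ A (k + 1))) ∪ (whitney d Q \ ⋃ k, A k) := by
    intro q hq
    by_cases h : q ∈ ⋃ k, A k
    · left
      obtain ⟨m, hm⟩ := mem_iUnion.1 h
      obtain ⟨n, hn⟩ := mem_iUnion.1 (subset_iUnion_diff_of_tsum hp hsum m hm)
      exact mem_iUnion.2 ⟨m + n, hq, hn⟩
    · exact Or.inr ⟨hq, h⟩
  have hzero : ∫⁻ q in whitney d Q \ ⋃ k, A k, f q ^ r.toReal ∂uhsMeasure d = 0 := by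
    set c := ∫⁻ q in whitney d Q \ ⋃ k, A k, f q ^ r.toReal ∂uhsMeasure d
    have hc : ∀ k : ℤ, c ≤ ((2:ℝ≥0∞) ^ k) ^ r.toReal * dyadicVol d Q.1 := fun k => by
      refine le_trans ?_ (setLIntegral_dyadicBox_le hr hr' (hsize k) Q)
      rw [setLIntegral_indicator_compl hρ0 f (hA k)]
      exact lintegral_mono_set (sdiff_subset_sdiff (whitney_subset_dyadicBox Q)
        (subset_iUnion A k))
    by_contra hne
    have hv0 := dyadicVol_ne_zero (d := d) Q.1
    have hvt := dyadicVol_ne_top (d := d) Q.1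
    have hct : c ≠ ∞ := ne_top_of_le_ne_top (ENNReal.mul_ne_top
      (ENNReal.rpow_ne_top_of_nonneg hρ0.le (two_zpow_ne_top 0)) hvt) (hc 0)
    have hx0 : c / dyadicVol d Q.1 ≠ 0 := (ENNReal.div_pos hne hvt).ne'
    have hxt : c / dyadicVol d Q.1 ≠ ∞ := ENNReal.div_ne_top hct hv0
    obtain ⟨n, hn, -⟩ := ENNReal.exists_mem_Ioc_zpow
      (x := (c / dyadicVol d Q.1) ^ r.toReal⁻¹)
      (ENNReal.rpow_pos hx0.bot_lt hxt).ne' (ENNReal.rpow_ne_top_of_nonneg (by positivity) hxt)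
      (y := 2) (by norm_num) (by simp)
    refine not_le.2 hn ?_
    rw [ENNReal.rpow_inv_le_iff hρ0, ENNReal.div_le_iff hv0 hvt]
    exact hc n
  calc ∫⁻ q in whitney d Q, f q ^ r.toReal ∂uhsMeasure d
      ≤ ∫⁻ q in (⋃ k, whitney d Q ∩ (A k \ A (k + 1))) ∪ (whitney d Q \ ⋃ k, A k),
          f q ^ r.toReal ∂uhsMeasure d := lintegral_mono_set hcov
    _ ≤ ∫⁻ q in ⋃ k, whitney d Q ∩ (A k \ A (k + 1)), f q ^ r.toReal ∂uhsMeasure d + 0 := by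
        rw [← hzero]; exact lintegral_union_le _ _ _
    _ ≤ _ := by rw [add_zero]; exact lintegral_iUnion_le _ _

end LevelSets

end HalfSpace

section Functionals

variable {d : ℕ} {r : ℝ≥0∞}

/-- The dyadic nontangential maximal function. -/
def whitneyMax (d : ℕ) (f : UHS d → ℝ≥0∞) (y : Fin d → ℝ) : ℝ≥0∞ :=
  ⨆ Q, (dyadicCube d Q).indicator
    (fun _ => essSup f ((uhsMeasure d).restrict (whitney d Q))) y

/-- The dyadic conical (area) functional with exponent `ρ`. -/
def dyadicArea (d : ℕ) (ρ : ℝ) (f : UHS d → ℝ≥0∞) (y : Fin d → ℝ) : ℝ≥0∞ :=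
  (∑' Q, (dyadicCube d Q).indicator
    (fun _ => (dyadicVol d Q.1)⁻¹ * ∫⁻ q in whitney d Q, f q ^ ρ ∂uhsMeasure d) y) ^ ρ⁻¹

/-- The dyadic Carleson functional with exponent `ρ`. -/
def dyadicCarleson (d : ℕ) (ρ : ℝ) (f : UHS d → ℝ≥0∞) (y : Fin d → ℝ) : ℝ≥0∞ :=
  ⨆ Q, (dyadicCube d Q).indicator
    (fun _ => ((dyadicVol d Q.1)⁻¹ *
      ∫⁻ q in dyadicBox d Q.1 Q.2, f q ^ ρ ∂uhsMeasure d) ^ ρ⁻¹) y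

lemma measurable_whitneyMax (f : UHS d → ℝ≥0∞) : Measurable (whitneyMax d f) :=
  Measurable.iSup fun Q => measurable_const.indicator (measurableSet_dyadicCube Q)

lemma measurable_dyadicArea (ρ : ℝ) (f : UHS d → ℝ≥0∞) : Measurable (dyadicArea d ρ f) :=
  (Measurable.tsum fun Q =>
    measurable_const.indicator (measurableSet_dyadicCube Q)).pow_const _

lemma measurable_dyadicCarleson (ρ : ℝ) (f : UHS d → ℝ≥0∞) : Measurable (dyadicCarleson d ρ f) :=
  Measurable.iSup fun Q => measurable_const.indicator (measurableSet_dyadicCube Q)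

lemma whitneyMax_tsum_le (f : ℕ → UHS d → ℝ≥0∞) (y : Fin d → ℝ) :
    whitneyMax d (fun q => ∑' n, f n q) y ≤ ∑' n, whitneyMax d (f n) y := by
  refine iSup_le fun Q => ?_
  by_cases hy : y ∈ dyadicCube d Q
  · rw [indicator_of_mem hy]
    refine (essSup_tsum_le f).trans (ENNReal.tsum_le_tsum fun n => ?_)
    refine le_iSup_of_le Q ?_
    rw [indicator_of_mem hy]
  · simp [hy]

lemma dyadicCarleson_tsum_le {ρ : ℝ} (hρ : 1 ≤ ρ) {f : ℕ → UHS d → ℝ≥0∞}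
    (hf : ∀ n, Measurable (f n)) (y : Fin d → ℝ) :
    dyadicCarleson d ρ (fun q => ∑' n, f n q) y ≤ ∑' n, dyadicCarleson d ρ (f n) y := by
  have hinv : 0 ≤ ρ⁻¹ := by positivity
  refine iSup_le fun Q => ?_
  by_cases hy : y ∈ dyadicCube d Q
  · rw [indicator_of_mem hy, ENNReal.mul_rpow_of_nonneg _ _ hinv]
    refine (mul_le_mul_right (lintegral_tsum_rpow_le hρ hf) _).trans ?_
    rw [← ENNReal.tsum_mul_left]
    refine ENNReal.tsum_le_tsum fun n => le_iSup_of_le Q ?_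
    rw [indicator_of_mem hy, ENNReal.mul_rpow_of_nonneg _ _ hinv]
  · simp [hy]

lemma dyadicArea_tsum_le {ρ : ℝ} (hρ : 1 ≤ ρ) {f : ℕ → UHS d → ℝ≥0∞}
    (hf : ∀ n, Measurable (f n)) (y : Fin d → ℝ) :
    dyadicArea d ρ (fun q => ∑' n, f n q) y ≤ ∑' n, dyadicArea d ρ (f n) y := by
  let ν : Measure (UHS d) := Measure.sum fun Q =>
    ((dyadicCube d Q).indicator (fun _ => (dyadicVol d Q.1)⁻¹) y) •
      (uhsMeasure d).restrict (whitney d Q)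
  have hν : ∀ g, dyadicArea d ρ g y = (∫⁻ q, g q ^ ρ ∂ν) ^ ρ⁻¹ := by
    intro g
    rw [dyadicArea, lintegral_sum_measure]
    congr 2 with Q
    rw [lintegral_smul_measure]
    by_cases hy : y ∈ dyadicCube d Q <;> simp [hy]
  simp_rw [hν]
  exact lintegral_tsum_rpow_le hρ hf

lemma superLevel_whitneyMax_le (hd : d ≠ 0) (f : UHS d → ℝ≥0∞) (l : ℝ≥0∞) :
    superLevel (dyadicOuter d) (uhsMeasure d) ∞ f l ≤ 2 * volume {y | l < whitneyMax d f y} := by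
  set S := {Q | l < essSup f ((uhsMeasure d).restrict (whitney d Q))}
  have hO : MeasurableSet {y | l < whitneyMax d f y} :=
    measurableSet_lt measurable_const (measurable_whitneyMax f)
  have hSO : ∀ Q ∈ S, dyadicCube d Q ⊆ {y | l < whitneyMax d f y} := fun Q hQ y hy => by
    refine lt_of_lt_of_le (show l < _ from hQ) (le_iSup_of_le Q ?_)
    rw [indicator_of_mem hy]
  refine (superLevel_le (A := ⋃ Q ∈ S, dyadicBox d Q.1 Q.2)
    (MeasurableSet.biUnion (to_countable S) fun Q _ => measurableSet_dyadicBox Q) ?_).trans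
    (dyadicOuter_biUnion_le hd hO S fun Q hQ => ?_)
  · rw [outerSup_top_le_iff]
    have hess : ∀ᵐ q ∂uhsMeasure d, ∀ Q, q ∈ whitney d Q →
        f q ≤ essSup f ((uhsMeasure d).restrict (whitney d Q)) :=
      ae_all_iff.2 fun Q => (ae_restrict_iff' (measurableSet_whitney Q)).1 (ENNReal.ae_le_essSup f)
    filter_upwards [hess, ae_mem_iUnion_whitney] with q hq hqW
    by_cases hqA : q ∈ ⋃ Q ∈ S, dyadicBox d Q.1 Q.2
    · simp only [indicator_of_notMem (notMem_compl_iff.2 hqA), zero_le]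
    · rw [indicator_of_mem (mem_compl hqA)]
      obtain ⟨Q, hQ⟩ := mem_iUnion.1 hqW
      refine (hq Q hQ).trans ?_
      by_contra! hlt
      exact hqA (mem_biUnion (show Q ∈ S from hlt) (whitney_subset_dyadicBox Q hQ))
  · rw [inter_eq_left.2 (hSO Q hQ), volume_dyadicCube]
    exact le_mul_of_one_le_left' (by norm_num)

lemma volume_whitneyMax_le {f : UHS d → ℝ≥0∞} {l : ℝ≥0∞} {A : Set (UHS d)}
    (h : outerSup (dyadicOuter d) (uhsMeasure d) ∞ (Aᶜ.indicator f) ≤ l) :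
    volume {y | l < whitneyMax d f y} ≤ dyadicOuter d A := by
  rw [outerSup_top_le_iff] at h
  refine volume_le_dyadicOuter fun y hy => ?_
  obtain ⟨Q, hQ⟩ := lt_iSup_iff.1 (show l < whitneyMax d f y from hy)
  by_cases hyQ : y ∈ dyadicCube d Q
  · refine ⟨Q, hyQ, ?_⟩
    rw [indicator_of_mem hyQ] at hQ
    by_contra hne
    rw [not_nonempty_iff_eq_empty, ← disjoint_iff_inter_eq_empty] at hne
    refine not_le.2 hQ (essSup_le_of_ae_le _ ?_)
    refine (ae_restrict_iff' (measurableSet_whitney Q)).2 ?_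
    filter_upwards [h] with q hq hqQ
    rwa [indicator_of_mem (disjoint_left.1 hne hqQ)] at hq
  · simp [hyQ] at hQ

lemma superLevel_dyadicCarleson_le (hd : d ≠ 0) (hr : 1 ≤ r) (hr' : r ≠ ∞) (f : UHS d → ℝ≥0∞)
    {l : ℝ≥0∞} (hl0 : l ≠ 0) (hl : l ≠ ∞) :
    superLevel (dyadicOuter d) (uhsMeasure d) r f l ≤
      2 * volume {y | l < dyadicCarleson d r.toReal f y} := by
  have hρ0 : 0 < r.toReal := by linarith [toReal_one_le hr hr']
  set S := {Q : ℤ × (Fin d → ℤ) | l < ((dyadicVol d Q.1)⁻¹ *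
      ∫⁻ q in dyadicBox d Q.1 Q.2, f q ^ r.toReal ∂uhsMeasure d) ^ r.toReal⁻¹}
  have hO : MeasurableSet {y | l < dyadicCarleson d r.toReal f y} :=
    measurableSet_lt measurable_const (measurable_dyadicCarleson _ f)
  have hSO : ∀ Q ∈ S, dyadicCube d Q ⊆ {y | l < dyadicCarleson d r.toReal f y} :=
    fun Q hQ y hy => by
      refine lt_of_lt_of_le (show l < _ from hQ) (le_iSup_of_le Q ?_)
      rw [indicator_of_mem hy]
  have hA : MeasurableSet (⋃ Q ∈ S, dyadicBox d Q.1 Q.2) :=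
    MeasurableSet.biUnion (to_countable S) fun Q _ => measurableSet_dyadicBox Q
  refine (superLevel_le hA ?_).trans (dyadicOuter_biUnion_le hd hO S fun Q hQ => ?_)
  · refine outerSup_le_of_dyadicBox hr hr' hl0 hl fun Q => ?_
    rw [setLIntegral_indicator_compl hρ0 f hA]
    by_cases hQ : Q ∈ S
    · rw [sdiff_eq_empty.2 (subset_biUnion_of_mem (u := fun Q : ℤ × (Fin d → ℤ) =>
        dyadicBox d Q.1 Q.2) hQ)]
      simp
    · have hQ' := not_lt.1 (show ¬ l < _ from hQ)
      rw [ENNReal.rpow_inv_le_iff hρ0, mul_comm, ← div_eq_mul_inv,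
        ENNReal.div_le_iff (dyadicVol_ne_zero _) (dyadicVol_ne_top _)] at hQ'
      exact (lintegral_mono_set sdiff_subset).trans hQ'
  · rw [inter_eq_left.2 (hSO Q hQ), volume_dyadicCube]
    exact le_mul_of_one_le_left' (by norm_num)

lemma volume_dyadicCarleson_le (hd : d ≠ 0) (hr : 1 ≤ r) (hr' : r ≠ ∞) {f : UHS d → ℝ≥0∞}
    {l : ℝ≥0∞} (hl0 : l ≠ 0) (hl : l ≠ ∞) {A : Set (UHS d)} (hA : MeasurableSet A)
    (h : outerSup (dyadicOuter d) (uhsMeasure d) r (Aᶜ.indicator f) ≤ l) :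
    volume {y | 2 * l < dyadicCarleson d r.toReal f y} ≤
      (l ^ r.toReal)⁻¹ * ∫⁻ q in A, f q ^ r.toReal ∂uhsMeasure d := by
  have hρ1 := toReal_one_le hr hr'
  have hρ0 : 0 < r.toReal := by linarith
  set ρ := r.toReal
  have hc0 : l ^ ρ ≠ 0 := (ENNReal.rpow_pos hl0.bot_lt hl).ne'
  have hct : l ^ ρ ≠ ∞ := ENNReal.rpow_ne_top_of_nonneg hρ0.le hl
  rcases eq_or_ne ((l ^ ρ)⁻¹ * ∫⁻ q in A, f q ^ ρ ∂uhsMeasure d) ∞ with hT | hT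
  · simp [hT]
  set S := {Q : ℤ × (Fin d → ℤ) | 2 * l < ((dyadicVol d Q.1)⁻¹ *
      ∫⁻ q in dyadicBox d Q.1 Q.2, f q ^ ρ ∂uhsMeasure d) ^ ρ⁻¹}
  have hvol : ∀ Q ∈ S, dyadicVol d Q.1 ≤
      (l ^ ρ)⁻¹ * ∫⁻ q in dyadicBox d Q.1 Q.2 ∩ A, f q ^ ρ ∂uhsMeasure d := by
    intro Q hQ
    have hv0 := dyadicVol_ne_zero (d := d) Q.1
    have hvt := dyadicVol_ne_top (d := d) Q.1
    have h1 : (2 * l) ^ ρ * dyadicVol d Q.1 <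
        ∫⁻ q in dyadicBox d Q.1 Q.2, f q ^ ρ ∂uhsMeasure d := by
      have hQ' : 2 * l < _ := hQ
      rwa [ENNReal.lt_rpow_inv_iff hρ0, mul_comm (dyadicVol d Q.1)⁻¹, ← div_eq_mul_inv,
        ENNReal.lt_div_iff_mul_lt (Or.inl hv0) (Or.inl hvt)] at hQ'
    have h2 : 2 * (l ^ ρ * dyadicVol d Q.1) ≤ (2 * l) ^ ρ * dyadicVol d Q.1 := by
      rw [ENNReal.mul_rpow_of_nonneg _ _ hρ0.le, ← mul_assoc]
      gcongr
      exact ENNReal.le_rpow_self_of_one_le (by norm_num) hρ1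
    have h3 : ∫⁻ q in dyadicBox d Q.1 Q.2 \ A, f q ^ ρ ∂uhsMeasure d ≤
        l ^ ρ * dyadicVol d Q.1 := by
      rw [← setLIntegral_indicator_compl hρ0 f hA]
      exact setLIntegral_dyadicBox_le hr hr' h Q
    rw [← lintegral_inter_add_sdiff _ _ hA] at h1
    have h4 : l ^ ρ * dyadicVol d Q.1 + l ^ ρ * dyadicVol d Q.1 ≤
        ∫⁻ q in dyadicBox d Q.1 Q.2 ∩ A, f q ^ ρ ∂uhsMeasure d + l ^ ρ * dyadicVol d Q.1 := by
      rw [← two_mul]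
      exact h2.trans (h1.le.trans (by gcongr))
    have h5 := (ENNReal.add_le_add_iff_right (ENNReal.mul_ne_top hct hvt)).1 h4
    rw [mul_comm, ← div_eq_mul_inv, ENNReal.le_div_iff_mul_le (Or.inl hc0) (Or.inl hct), mul_comm]
    exact h5
  obtain ⟨M, -, hM, hdom⟩ := exists_maximal_cubes hd hT S fun M hMS hdisj => by
    have hdisj' : Pairwise (Function.onFun Disjoint
        fun Q : M => dyadicBox d Q.1.1 Q.1.2 ∩ A) := fun Q R hne => by
      refine disjoint_left.2 fun q hq hq' => ?_
      exact disjoint_left.1 (hdisj Q.2 R.2 (fun h => hne (Subtype.ext h))) hq.1.1 hq'.1.1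
    calc ∑' Q : M, dyadicVol d Q.1.1
        ≤ ∑' Q : M, (l ^ ρ)⁻¹ *
            ∫⁻ q in dyadicBox d Q.1.1 Q.1.2 ∩ A, f q ^ ρ ∂uhsMeasure d :=
          ENNReal.tsum_le_tsum fun Q => hvol Q.1 (hMS Q.2)
      _ = (l ^ ρ)⁻¹ * ∫⁻ q in ⋃ Q : M, dyadicBox d Q.1.1 Q.1.2 ∩ A, f q ^ ρ ∂uhsMeasure d := by
          rw [ENNReal.tsum_mul_left, lintegral_iUnion
            (fun Q : M => (measurableSet_dyadicBox Q.1).inter hA) hdisj']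
      _ ≤ _ := by
          gcongr
          exact iUnion_subset fun _ => inter_subset_right
  calc volume {y | 2 * l < dyadicCarleson d ρ f y} ≤ volume (⋃ Q ∈ M, dyadicCube d Q) := by
        refine measure_mono fun y hy => ?_
        obtain ⟨Q, hQ⟩ := lt_iSup_iff.1 (show 2 * l < dyadicCarleson d ρ f y from hy)
        by_cases hyQ : y ∈ dyadicCube d Q
        · rw [indicator_of_mem hyQ] at hQ
          obtain ⟨R, hR, -, hsub⟩ := hdom Q hQ
          exact mem_biUnion hR (hsub hyQ)
        · simp [hyQ] at hQ
    _ ≤ ∑' Q : M, volume (dyadicCube d Q.1) := measure_biUnion_le _ (to_countable M) _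
    _ ≤ _ := by simpa only [volume_dyadicCube] using hM

end Functionals

section Comparison

variable {d : ℕ} {r : ℝ≥0∞}

lemma two_mul_rpow_le {ρ : ℝ} (hρ : 1 ≤ ρ) (l : ℝ≥0∞) : 2 * l ^ ρ ≤ (2 * l) ^ ρ := by
  rw [ENNReal.mul_rpow_of_nonneg _ _ (by linarith)]
  gcongr
  exact ENNReal.le_rpow_self_of_one_le (by norm_num) hρ

lemma dyadicVol_le_two_mul_volume_diff {O : Set (Fin d → ℝ)} (hO : MeasurableSet O)
    {Q : ℤ × (Fin d → ℤ)} (h : 2 * volume (dyadicCube d Q ∩ O) < dyadicVol d Q.1) :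
    dyadicVol d Q.1 ≤ 2 * volume (dyadicCube d Q \ O) := by
  rw [← volume_dyadicCube, ← measure_inter_add_sdiff (dyadicCube d Q) hO] at h ⊢
  have ht : volume (dyadicCube d Q ∩ O) ≠ ∞ :=
    ne_top_of_le_ne_top (by rw [volume_dyadicCube]; exact dyadicVol_ne_top _)
      (measure_mono (inter_subset_left (t := O)))
  rw [two_mul] at h ⊢
  refine add_le_add_left ?_ _
  exact ((ENNReal.add_lt_add_iff_left ht).1 h).le

lemma superLevel_dyadicArea_le (hd : d ≠ 0) (hr : 1 ≤ r) (hr' : r ≠ ∞) (f : UHS d → ℝ≥0∞)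
    {l : ℝ≥0∞} (hl0 : l ≠ 0) (hl : l ≠ ∞) :
    superLevel (dyadicOuter d) (uhsMeasure d) r f (2 * l) ≤
      2 * volume {y | l < dyadicArea d r.toReal f y} := by
  have hρ1 := toReal_one_le hr hr'
  have hρ0 : 0 < r.toReal := by linarith
  set ρ := r.toReal
  set O := {y | l < dyadicArea d ρ f y} with hOdef
  have hO : MeasurableSet O := measurableSet_lt measurable_const (measurable_dyadicArea _ f)
  set S := {Q : ℤ × (Fin d → ℤ) | dyadicVol d Q.1 ≤ 2 * volume (dyadicCube d Q ∩ O)}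
  have hA : MeasurableSet (⋃ Q ∈ S, dyadicBox d Q.1 Q.2) :=
    MeasurableSet.biUnion (to_countable S) fun Q _ => measurableSet_dyadicBox Q
  refine (superLevel_le hA ?_).trans (dyadicOuter_biUnion_le hd hO S fun Q hQ => hQ)
  refine outerSup_le_of_dyadicBox hr hr' (mul_ne_zero (by simp) hl0)
    (ENNReal.mul_ne_top (by simp) hl) fun Q => ?_
  rw [setLIntegral_indicator_compl hρ0 f hA,
    lintegral_eq_tsum_whitney _ ((measurableSet_dyadicBox Q).diff hA)]
  let a : ℤ × (Fin d → ℤ) → ℝ≥0∞ := fun R => ∫⁻ q in whitney d R, f q ^ ρ ∂uhsMeasure d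
  have hterm : ∀ R, ∫⁻ q in whitney d R ∩ (dyadicBox d Q.1 Q.2 \ ⋃ Q ∈ S, dyadicBox d Q.1 Q.2),
      f q ^ ρ ∂uhsMeasure d ≤ 2 * ∫⁻ y in dyadicCube d Q \ O,
        (dyadicCube d R).indicator (fun _ => (dyadicVol d R.1)⁻¹ * a R) y := by
    intro R
    rcases (whitney d R ∩ (dyadicBox d Q.1 Q.2 \ ⋃ Q ∈ S, dyadicBox d Q.1 Q.2)).eq_empty_or_nonempty
      with he | ⟨q, hqR, hqQ, hqA⟩
    · simp [he]
    have hsub := (dyadicCube_subset_of_whitney hqR hqQ).2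
    have hRS : ¬ dyadicVol d R.1 ≤ 2 * volume (dyadicCube d R ∩ O) := fun hR =>
      hqA (mem_biUnion (show R ∈ S from hR) (whitney_subset_dyadicBox R hqR))
    have hvol := dyadicVol_le_two_mul_volume_diff hO (not_le.1 hRS)
    have hset : dyadicCube d R ∩ (dyadicCube d Q \ O) = dyadicCube d R \ O := by
      ext y
      simp only [mem_inter_iff, mem_sdiff]
      exact ⟨fun h => ⟨h.1, h.2.2⟩, fun h => ⟨h.1, hsub h.1, h.2⟩⟩
    rw [setLIntegral_indicator (measurableSet_dyadicCube R), hset, setLIntegral_const]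
    calc _ ≤ a R := lintegral_mono_set inter_subset_left
      _ = (dyadicVol d R.1)⁻¹ * a R * dyadicVol d R.1 := by
          rw [mul_right_comm, ENNReal.inv_mul_cancel (dyadicVol_ne_zero _) (dyadicVol_ne_top _),
            one_mul]
      _ ≤ (dyadicVol d R.1)⁻¹ * a R * (2 * volume (dyadicCube d R \ O)) := by gcongr
      _ = _ := by ring
  calc _ ≤ ∑' R, 2 * ∫⁻ y in dyadicCube d Q \ O,
        (dyadicCube d R).indicator (fun _ => (dyadicVol d R.1)⁻¹ * a R) y :=
        ENNReal.tsum_le_tsum hterm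
    _ = 2 * ∫⁻ y in dyadicCube d Q \ O, dyadicArea d ρ f y ^ ρ := by
        rw [ENNReal.tsum_mul_left, ← lintegral_tsum fun R =>
          (measurable_const.indicator (measurableSet_dyadicCube R)).aemeasurable]
        simp_rw [dyadicArea, ENNReal.rpow_inv_rpow hρ0.ne']
        rfl
    _ ≤ 2 * ∫⁻ _ in dyadicCube d Q \ O, l ^ ρ := by
        gcongr 2 * ?_
        refine setLIntegral_mono' ((measurableSet_dyadicCube Q).diff hO) fun y hy => ?_
        gcongr
        exact not_lt.1 hy.2
    _ ≤ 2 * (l ^ ρ * dyadicVol d Q.1) := by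
        rw [setLIntegral_const, ← volume_dyadicCube]
        gcongr
        exact sdiff_subset
    _ ≤ _ := by
        rw [← mul_assoc]
        gcongr
        exact two_mul_rpow_le hρ1 l

/-- A concavity estimate on the support of `g`. -/
lemma lintegral_rpow_le_of_support {X : Type*} [MeasurableSpace X] {ν : Measure X} {q : ℝ}
    (hq0 : 0 < q) (hq1 : q ≤ 1) {g : X → ℝ≥0∞} (hg : Measurable g) {b M : ℝ≥0∞} (hb0 : b ≠ 0)
    (hb : b ≠ ∞) (hint : ∫⁻ x, g x ∂ν ≤ b * M) (hsupp : ν {x | g x ≠ 0} ≤ M) :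
    ∫⁻ x, g x ^ q ∂ν ≤ 2 * (b ^ q * M) := by
  have hS : MeasurableSet {x | g x ≠ 0} := (measurableSet_eq_fun hg measurable_const).compl
  have hpt : ∀ x, g x ^ q ≤ {x | g x ≠ 0}.indicator (fun _ => b ^ q) x + b ^ (q - 1) * g x := by
    intro x
    rcases eq_or_ne (g x) 0 with h0 | h0
    · simp [h0, hq0]
    rcases eq_or_ne (g x) ∞ with ht | ht
    · rw [ht, ENNReal.mul_top (ENNReal.rpow_pos hb0.bot_lt hb).ne']
      simp
    rcases le_total (g x) b with h | h
    · rw [indicator_of_mem (show x ∈ {x | g x ≠ 0} from h0)]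
      exact le_add_right (by gcongr)
    · refine le_add_left ?_
      calc g x ^ q = g x ^ (q - 1) * g x := by
            conv_rhs => rw [← ENNReal.rpow_one (g x), ← ENNReal.rpow_mul, one_mul]
            rw [← ENNReal.rpow_add _ _ h0 ht]
            simp
        _ ≤ b ^ (q - 1) * g x := by
            gcongr ?_ * _
            rw [← neg_sub, ENNReal.rpow_neg, ENNReal.rpow_neg]
            gcongr
  calc ∫⁻ x, g x ^ q ∂ν
      ≤ ∫⁻ x, {x | g x ≠ 0}.indicator (fun _ => b ^ q) x + b ^ (q - 1) * g x ∂ν :=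
        lintegral_mono hpt
    _ = b ^ q * ν {x | g x ≠ 0} + b ^ (q - 1) * ∫⁻ x, g x ∂ν := by
        rw [lintegral_add_left (measurable_const.indicator hS), lintegral_indicator_const hS,
          lintegral_const_mul _ hg]
    _ ≤ b ^ q * M + b ^ (q - 1) * (b * M) := by gcongr
    _ = _ := by
        have : b ^ (q - 1) * b = b ^ q := by
          conv_lhs => rw [← ENNReal.rpow_one b, ← ENNReal.rpow_mul, one_mul]
          rw [← ENNReal.rpow_add _ _ hb0 hb]
          simp
        rw [← mul_assoc, this, two_mul]

lemma lintegral_dyadicArea_le {p : ℝ} (hp : 0 < p) (hr : 1 ≤ r) (hr' : r ≠ ∞)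
    (hpr : p ≤ r.toReal) {f : UHS d → ℝ≥0∞} {A : ℤ → Set (UHS d)} (hA : ∀ k, MeasurableSet (A k))
    (hsize : ∀ k, outerSup (dyadicOuter d) (uhsMeasure d) r ((A k)ᶜ.indicator f) ≤ 2 ^ k)
    (hsum : ∑' k : ℤ, ((2:ℝ≥0∞) ^ k) ^ p * dyadicOuter d (A k) ≠ ∞) :
    ∫⁻ y, dyadicArea d r.toReal f y ^ p ≤
      2 * 2 ^ p * ∑' k : ℤ, ((2:ℝ≥0∞) ^ k) ^ p * dyadicOuter d (A k) := by
  have hρ1 := toReal_one_le hr hr'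
  have hρ0 : 0 < r.toReal := by linarith
  have hq0 : 0 < r.toReal⁻¹ * p := by positivity
  have hq1 : r.toReal⁻¹ * p ≤ 1 := by
    rw [inv_mul_le_iff₀ hρ0, mul_one]; exact hpr
  let a : ℤ → ℤ × (Fin d → ℤ) → ℝ≥0∞ := fun k Q =>
    ∫⁻ q in whitney d Q ∩ (A k \ A (k + 1)), f q ^ r.toReal ∂uhsMeasure d
  let G : ℤ → (Fin d → ℝ) → ℝ≥0∞ := fun k y =>
    ∑' Q, (dyadicCube d Q).indicator (fun _ => (dyadicVol d Q.1)⁻¹ * a k Q) y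
  have hGm : ∀ k Q, Measurable
      ((dyadicCube d Q).indicator fun _ => (dyadicVol d Q.1)⁻¹ * a k Q) := fun k Q =>
    measurable_const.indicator (measurableSet_dyadicCube Q)
  have hG : ∀ k, Measurable (G k) := fun k => Measurable.tsum (hGm k)
  have hpt : ∀ y, dyadicArea d r.toReal f y ^ p ≤ ∑' k, G k y ^ (r.toReal⁻¹ * p) := by
    intro y
    rw [dyadicArea, ← ENNReal.rpow_mul]
    refine le_trans ?_ (tsum_rpow_le_tsum hq0 hq1 _)
    gcongr
    rw [ENNReal.tsum_comm]
    refine ENNReal.tsum_le_tsum fun Q => ?_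
    by_cases hy : y ∈ dyadicCube d Q
    · simp only [indicator_of_mem hy]
      rw [ENNReal.tsum_mul_left]
      gcongr
      exact setLIntegral_whitney_le_tsum hr hr' hA hsize hp hsum Q
    · simp [hy]
  have hone : ∀ k, ∫⁻ y, G k y ^ (r.toReal⁻¹ * p) ≤
      2 * (((2:ℝ≥0∞) ^ (k + 1)) ^ p * dyadicOuter d (A k)) := by
    intro k
    have hb0 := (ENNReal.rpow_pos (p := r.toReal) (two_zpow_ne_zero (k + 1)).bot_lt
      (two_zpow_ne_top (k + 1))).ne'
    have hbt := ENNReal.rpow_ne_top_of_nonneg hρ0.le (two_zpow_ne_top (k + 1))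
    have h := lintegral_rpow_le_of_support (ν := volume) hq0 hq1 (hG k) hb0 hbt
      (M := dyadicOuter d (A k)) ?_ ?_
    · rwa [← ENNReal.rpow_mul, mul_inv_cancel_left₀ hρ0.ne'] at h
    · calc ∫⁻ y, G k y = ∑' Q, a k Q := by
            rw [lintegral_tsum fun Q => (hGm k Q).aemeasurable]
            congr 1 with Q
            rw [lintegral_indicator_const (measurableSet_dyadicCube Q), volume_dyadicCube,
              mul_right_comm, ENNReal.inv_mul_cancel (dyadicVol_ne_zero _) (dyadicVol_ne_top _),
              one_mul]
        _ = ∫⁻ q in A k \ A (k + 1), f q ^ r.toReal ∂uhsMeasure d :=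
            (lintegral_eq_tsum_whitney _ ((hA k).diff (hA (k + 1)))).symm
        _ ≤ _ := setLIntegral_diff_le hr hr' hA hsize hsum k
    · refine volume_le_dyadicOuter fun y hy => ?_
      by_contra! hno
      refine (show G k y ≠ 0 from hy) (ENNReal.tsum_eq_zero.2 fun Q => ?_)
      by_cases hyQ : y ∈ dyadicCube d Q
      · have he : whitney d Q ∩ (A k \ A (k + 1)) = ∅ :=
          subset_eq_empty (inter_subset_inter_right _ sdiff_subset) (hno Q hyQ)
        simp [a, he]
      · simp [hyQ]
  calc ∫⁻ y, dyadicArea d r.toReal f y ^ p ≤ ∫⁻ y, ∑' k, G k y ^ (r.toReal⁻¹ * p) :=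
        lintegral_mono hpt
    _ = ∑' k, ∫⁻ y, G k y ^ (r.toReal⁻¹ * p) :=
        lintegral_tsum fun k => ((hG k).pow_const _).aemeasurable
    _ ≤ ∑' k : ℤ, 2 * (((2:ℝ≥0∞) ^ (k + 1)) ^ p * dyadicOuter d (A k)) :=
        ENNReal.tsum_le_tsum hone
    _ = _ := by
        rw [← ENNReal.tsum_mul_left]
        congr 1 with k
        rw [ENNReal.zpow_add (by simp) (by simp), zpow_one, ENNReal.mul_rpow_of_nonneg _ _ hp.le]
        ring

lemma lintegral_whitneyMax_le {p : ℝ} (hp : 0 < p) {f : UHS d → ℝ≥0∞} {A : ℤ → Set (UHS d)}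
    (hsize : ∀ k, outerSup (dyadicOuter d) (uhsMeasure d) ∞ ((A k)ᶜ.indicator f) ≤ 2 ^ k) :
    ∫⁻ y, whitneyMax d f y ^ p ≤
      2 ^ p * ∑' k : ℤ, ((2:ℝ≥0∞) ^ k) ^ p * dyadicOuter d (A k) := by
  refine (lintegral_rpow_le_tsum_measure hp (measurable_whitneyMax f)).trans ?_
  gcongr with k
  exact volume_whitneyMax_le (hsize k)

lemma lintegral_dyadicCarleson_le (hd : d ≠ 0) {p : ℝ} (hr : 1 ≤ r) (hr' : r ≠ ∞)
    (hpr : r.toReal < p) {f : UHS d → ℝ≥0∞} {A : ℤ → Set (UHS d)} (hA : ∀ k, MeasurableSet (A k))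
    (hsize : ∀ k, outerSup (dyadicOuter d) (uhsMeasure d) r ((A k)ᶜ.indicator f) ≤ 2 ^ k)
    (hsum : ∑' k : ℤ, ((2:ℝ≥0∞) ^ k) ^ p * dyadicOuter d (A k) ≠ ∞) :
    ∫⁻ y, dyadicCarleson d r.toReal f y ^ p ≤
      2 ^ p * 2 ^ p * 2 ^ r.toReal * (1 - (2:ℝ≥0∞) ^ (r.toReal - p))⁻¹ *
        ∑' k : ℤ, ((2:ℝ≥0∞) ^ k) ^ p * dyadicOuter d (A k) := by
  have hρ1 := toReal_one_le hr hr'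
  have hρ0 : 0 < r.toReal := by linarith
  have hp : 0 < p := by linarith
  set ρ := r.toReal
  set D := ∑' k : ℤ, ((2:ℝ≥0∞) ^ k) ^ p * dyadicOuter d (A k)
  have hint : ∀ m : ℤ, ∫⁻ q in A m, f q ^ ρ ∂uhsMeasure d ≤
      ∑' n : ℕ, ((2:ℝ≥0∞) ^ (m + n + 1)) ^ ρ * dyadicOuter d (A (m + n)) := fun m =>
    calc ∫⁻ q in A m, f q ^ ρ ∂uhsMeasure d
        ≤ ∫⁻ q in ⋃ n : ℕ, A (m + n) \ A (m + n + 1), f q ^ ρ ∂uhsMeasure d :=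
          lintegral_mono_set (subset_iUnion_diff_of_tsum hp hsum m)
      _ ≤ ∑' n : ℕ, ∫⁻ q in A (m + n) \ A (m + n + 1), f q ^ ρ ∂uhsMeasure d :=
          lintegral_iUnion_le _ _
      _ ≤ _ := ENNReal.tsum_le_tsum fun n => setLIntegral_diff_le hr hr' hA hsize hsum _
  have hident : ∀ (m : ℤ) (n : ℕ) (M : ℝ≥0∞),
      ((2:ℝ≥0∞) ^ m) ^ p * ((((2:ℝ≥0∞) ^ m) ^ ρ)⁻¹ * (((2:ℝ≥0∞) ^ (m + n + 1)) ^ ρ * M)) =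
        2 ^ ρ * (((2:ℝ≥0∞) ^ (ρ - p)) ^ n * (((2:ℝ≥0∞) ^ (m + n)) ^ p * M)) := by
    intro m n M
    have e : ∀ k : ℤ, (2:ℝ≥0∞) ^ k = (2:ℝ≥0∞) ^ (k:ℝ) := fun k => (ENNReal.rpow_intCast _ _).symm
    simp only [e, ← ENNReal.rpow_natCast, ← ENNReal.rpow_mul, ← ENNReal.rpow_neg, ← mul_assoc]
    congr 1
    simp only [← ENNReal.rpow_add _ _ (two_ne_zero : (2:ℝ≥0∞) ≠ 0) ENNReal.ofNat_ne_top]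
    congr 1
    push_cast
    ring
  have hmain : ∑' m : ℤ, ((2:ℝ≥0∞) ^ m) ^ p * volume {y | 2 * 2 ^ m < dyadicCarleson d ρ f y} ≤
      2 ^ ρ * ((1 - (2:ℝ≥0∞) ^ (ρ - p))⁻¹ * D) :=
    calc _ ≤ ∑' m : ℤ, ((2:ℝ≥0∞) ^ m) ^ p * ((((2:ℝ≥0∞) ^ m) ^ ρ)⁻¹ *
          ∑' n : ℕ, ((2:ℝ≥0∞) ^ (m + n + 1)) ^ ρ * dyadicOuter d (A (m + n))) := by
          gcongr with m
          refine (volume_dyadicCarleson_le hd hr hr' (two_zpow_ne_zero m) (two_zpow_ne_top m)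
            (hA m) (hsize m)).trans ?_
          gcongr
          exact hint m
      _ = ∑' (m : ℤ) (n : ℕ), 2 ^ ρ * (((2:ℝ≥0∞) ^ (ρ - p)) ^ n *
          (((2:ℝ≥0∞) ^ (m + n)) ^ p * dyadicOuter d (A (m + n)))) := by
          simp_rw [← ENNReal.tsum_mul_left, hident]
      _ = ∑' n : ℕ, 2 ^ ρ * (((2:ℝ≥0∞) ^ (ρ - p)) ^ n * D) := by
          rw [ENNReal.tsum_comm]
          congr 1 with n
          rw [ENNReal.tsum_mul_left, ENNReal.tsum_mul_left]
          congr 2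
          exact (Equiv.addRight (n:ℤ)).tsum_eq
            fun k : ℤ => ((2:ℝ≥0∞) ^ k) ^ p * dyadicOuter d (A k)
      _ = _ := by rw [ENNReal.tsum_mul_left, ENNReal.tsum_mul_right, ENNReal.tsum_geometric]
  calc ∫⁻ y, dyadicCarleson d ρ f y ^ p
      ≤ 2 ^ p * ∑' m : ℤ, ((2:ℝ≥0∞) ^ m) ^ p * volume {y | 2 ^ m < dyadicCarleson d ρ f y} :=
        lintegral_rpow_le_tsum_measure hp (measurable_dyadicCarleson ρ f)
    _ = 2 ^ p * (2 ^ p * ∑' m : ℤ, ((2:ℝ≥0∞) ^ m) ^ p *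
          volume {y | 2 * 2 ^ m < dyadicCarleson d ρ f y}) := by
        congr 1
        rw [← (Equiv.addRight (1:ℤ)).tsum_eq, ← ENNReal.tsum_mul_left]
        refine tsum_congr fun m => ?_
        have h2 : (2:ℝ≥0∞) ^ (m + 1) = 2 * 2 ^ m := by
          rw [ENNReal.zpow_add (by simp) (by simp), zpow_one, mul_comm]
        simp only [Equiv.coe_addRight, h2]
        rw [ENNReal.mul_rpow_of_nonneg _ _ hp.le, mul_assoc]
    _ ≤ 2 ^ p * (2 ^ p * (2 ^ ρ * ((1 - (2:ℝ≥0∞) ^ (ρ - p))⁻¹ * D))) := by gcongr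
    _ = _ := by ring

end Comparison

section DimensionZero

lemma dyadicVol_zero (j : ℤ) : dyadicVol 0 j = 1 := by simp [dyadicVol]

lemma one_le_dyadicOuter_zero {A : Set (UHS 0)} (hA : A.Nonempty) : 1 ≤ dyadicOuter 0 A := by
  refine le_iInf₂ fun M hM => ?_
  obtain ⟨q, hq⟩ := hA
  obtain ⟨Q, hQ, -⟩ := mem_iUnion₂.1 (hM hq)
  calc (1:ℝ≥0∞) = dyadicVol 0 (⟨Q, hQ⟩ : M).1.1 := (dyadicVol_zero _).symm
    _ ≤ _ := ENNReal.le_tsum (f := fun e : M => dyadicVol 0 e.1.1) _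

lemma dyadicBox_zero_subset {j k : ℤ} (h : j ≤ k) (x y : Fin 0 → ℤ) :
    dyadicBox 0 j x ⊆ dyadicBox 0 k y :=
  dyadicBox_subset (Q := (j, x)) (R := (k, y)) h fun _ _ i => i.elim0

lemma subset_dyadicBox_of_dyadicOuter_zero_ne_top {A : Set (UHS 0)} (h : dyadicOuter 0 A ≠ ∞) :
    ∃ j : ℤ, A ⊆ dyadicBox 0 j 0 := by
  obtain ⟨M, hM⟩ := iInf_lt_iff.1 h.lt_top
  obtain ⟨hMA, hMt⟩ := iInf_lt_iff.1 hM
  simp_rw [dyadicVol_zero] at hMt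
  have hfin : M.Finite := by
    by_contra hinf
    have : Infinite M := infinite_coe_iff.2 hinf
    exact hMt.ne (ENNReal.tsum_const_eq_top_of_ne_zero one_ne_zero)
  obtain ⟨J, hJ⟩ := (hfin.image Prod.fst).bddAbove
  refine ⟨J, hMA.trans (iUnion₂_subset fun Q hQ => ?_)⟩
  exact dyadicBox_zero_subset (hJ (mem_image_of_mem _ hQ)) _ _

variable {p r : ℝ≥0∞}

lemma one_le_superLevel_zero {f : UHS 0 → ℝ≥0∞} {l : ℝ≥0∞}
    (h : l < outerSup (dyadicOuter 0) (uhsMeasure 0) r f) :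
    1 ≤ superLevel (dyadicOuter 0) (uhsMeasure 0) r f l := by
  refine le_iInf₂ fun A _ => le_iInf fun hA => one_le_dyadicOuter_zero ?_
  by_contra hne
  rw [not_nonempty_iff_eq_empty.1 hne, compl_empty, indicator_univ] at hA
  exact not_le.2 h hA

lemma outerSup_le_outerLp_zero (hp : 1 ≤ p) (hp' : p ≠ ∞) (f : UHS 0 → ℝ≥0∞) :
    outerSup (dyadicOuter 0) (uhsMeasure 0) r f ≤
      4 * outerLp (dyadicOuter 0) (uhsMeasure 0) p r f := by
  have hP1 := toReal_one_le hp hp'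
  have hP0 : 0 < p.toReal := by linarith
  rw [outerLp, if_neg hp', ← ENNReal.rpow_le_rpow_iff hP0, ENNReal.mul_rpow_of_nonneg _ _ hP0.le,
    ENNReal.rpow_inv_rpow hP0.ne']
  refine (rpow_le_tsum_zpow hP0 _).trans ?_
  have h4 : (4:ℝ≥0∞) ^ p.toReal = 2 ^ p.toReal * 2 ^ p.toReal := by
    rw [← ENNReal.mul_rpow_of_nonneg _ _ hP0.le]; norm_num
  rw [h4, mul_assoc]
  gcongr
  refine le_trans (ENNReal.tsum_le_tsum fun k => ?_)
    (tsum_zpow_le_lintegral hP1 (superLevel_antitone f))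
  gcongr
  exact indicator_le (fun x hx => one_le_superLevel_zero hx) _

lemma superLevel_ne_top_of_outerLp {X : Type*} [MeasurableSpace X] {μ : Set X → ℝ≥0∞}
    {ν : Measure X} (hp : 1 ≤ p) (hp' : p ≠ ∞) {f : X → ℝ≥0∞} (h : outerLp μ ν p r f ≠ ∞)
    {l : ℝ≥0∞} (hl : l ≠ 0) : superLevel μ ν r f l ≠ ∞ := by
  have hP1 := toReal_one_le hp hp'
  have hP0 : 0 < p.toReal := by linarith
  wlog hlt : l ≠ ∞ generalizing l
  · exact ne_top_of_le_ne_top (this one_ne_zero ENNReal.one_ne_top)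
      (superLevel_antitone f (by simp [not_not.1 hlt]))
  obtain ⟨k, hk, -⟩ := ENNReal.exists_mem_Ioc_zpow hl hlt (y := 2) (by norm_num) (by simp)
  refine ne_top_of_le_ne_top ?_ (superLevel_antitone f hk.le)
  rw [outerLp, if_neg hp'] at h
  have hI := mt (ENNReal.rpow_eq_top_iff_of_pos (inv_pos.2 hP0)).2 h
  have hk' := ENNReal.ne_top_of_tsum_ne_top (ne_top_of_le_ne_top
    (ENNReal.mul_ne_top (ENNReal.rpow_ne_top_of_nonneg hP0.le (by simp)) hI)
    (tsum_zpow_le_lintegral hP1 (superLevel_antitone (μ := μ) (ν := ν) (r := r) f))) k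
  intro ht
  rw [ht, ENNReal.mul_top (ENNReal.rpow_pos (two_zpow_ne_zero k).bot_lt (two_zpow_ne_top k)).ne']
    at hk'
  exact hk' rfl

lemma superLevel_tsum_le_one_zero (hr : 1 ≤ r) {f : ℕ → UHS 0 → ℝ≥0∞}
    (hf : ∀ n, Measurable (f n))
    (hfin : ∀ n, ∀ l : ℝ≥0∞, l ≠ 0 → superLevel (dyadicOuter 0) (uhsMeasure 0) r (f n) l ≠ ∞)
    (hsum : ∑' n, outerSup (dyadicOuter 0) (uhsMeasure 0) r (f n) ≠ ∞) {l : ℝ≥0∞} (hl : l ≠ 0) :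
    superLevel (dyadicOuter 0) (uhsMeasure 0) r (fun q => ∑' n, f n q) l ≤ 1 := by
  have hl2 : l / 2 ≠ 0 := (ENNReal.half_pos hl).ne'
  obtain ⟨ε, hε0, hε⟩ := ENNReal.exists_pos_sum_of_countable hl2 ℕ
  have hA : ∀ n, ∃ j : ℤ, outerSup (dyadicOuter 0) (uhsMeasure 0) r
      ((dyadicBox 0 j 0)ᶜ.indicator (f n)) ≤ ε n := by
    intro n
    obtain ⟨A, -, hA, hAt⟩ := exists_of_superLevel_lt
      (hfin n (ε n) (by exact_mod_cast (hε0 n).ne')).lt_top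
    obtain ⟨j, hj⟩ := subset_dyadicBox_of_dyadicOuter_zero_ne_top hAt.ne
    refine ⟨j, (outerSup_mono_fun fun q => ?_).trans hA⟩
    exact indicator_le_indicator_of_subset (compl_subset_compl.2 hj) (fun _ => zero_le) q
  choose j hj using hA
  obtain ⟨N, hN⟩ := ((ENNReal.tendsto_sum_nat_add _ hsum).eventually_le_const hl2.bot_lt).exists
  obtain ⟨J, hJ⟩ := ((finite_lt_nat N).image j).bddAbove
  have hB : dyadicOuter 0 (dyadicBox 0 J 0) ≤ 1 :=
    (dyadicOuter_dyadicBox_le (J, 0)).trans (dyadicVol_zero J).le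
  refine (superLevel_le (measurableSet_dyadicBox (J, 0)) ?_).trans hB
  have hind : (dyadicBox 0 J 0)ᶜ.indicator (fun q => ∑' n, f n q) =
      fun q => ∑' n, (dyadicBox 0 J 0)ᶜ.indicator (f n) q := by
    ext q
    by_cases hq : q ∈ (dyadicBox 0 J 0)ᶜ
    · simp only [indicator_of_mem hq]
    · simp only [indicator_of_notMem hq, tsum_zero]
  rw [hind]
  refine (outerSup_tsum_le hr fun n => (hf n).indicator
    (measurableSet_dyadicBox (J, 0)).compl).trans ?_
  rw [← ENNReal.summable.sum_add_tsum_nat_add' (k := N), ← ENNReal.add_halves l]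
  gcongr
  · refine le_trans (Finset.sum_le_sum fun n hn => ?_) ((ENNReal.sum_le_tsum _).trans hε.le)
    refine (outerSup_mono_fun fun q => ?_).trans (hj n)
    refine indicator_le_indicator_of_subset (compl_subset_compl.2 ?_) (fun _ => zero_le) q
    exact dyadicBox_zero_subset (hJ (mem_image_of_mem j (Finset.mem_range.1 hn))) _ _
  · refine le_trans (ENNReal.tsum_le_tsum fun n => ?_) hN
    exact outerSup_mono_fun fun q => indicator_le_self _ _ q

lemma outerLp_tsum_le_zero (hp : 1 ≤ p) (hp' : p ≠ ∞) (hr : 1 ≤ r) {f : ℕ → UHS 0 → ℝ≥0∞}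
    (hf : ∀ n, Measurable (f n)) :
    outerLp (dyadicOuter 0) (uhsMeasure 0) p r (fun q => ∑' n, f n q) ≤
      4 * ∑' n, outerLp (dyadicOuter 0) (uhsMeasure 0) p r (f n) := by
  have hP0 : 0 < p.toReal := by linarith [toReal_one_le hp hp']
  rcases eq_or_ne (∑' n, outerLp (dyadicOuter 0) (uhsMeasure 0) p r (f n)) ∞ with ht | ht
  · simp [ht]
  set T := ∑' n, outerSup (dyadicOuter 0) (uhsMeasure 0) r (f n)
  have hT : T ≤ 4 * ∑' n, outerLp (dyadicOuter 0) (uhsMeasure 0) p r (f n) := by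
    rw [← ENNReal.tsum_mul_left]
    exact ENNReal.tsum_le_tsum fun n => outerSup_le_outerLp_zero hp hp' (f n)
  have hTt : T ≠ ∞ := ne_top_of_le_ne_top (ENNReal.mul_ne_top (by simp) ht) hT
  refine le_trans ?_ hT
  rw [outerLp, if_neg hp', ENNReal.rpow_inv_le_iff hP0]
  have hdirac : ∫⁻ _, T ^ p.toReal ∂(Measure.dirac ()) = T ^ p.toReal := by simp
  rw [← hdirac]
  refine le_trans ?_ (lintegral_measure_lt_le hP0 measurable_const)
  refine setLIntegral_mono' measurableSet_Ioi fun l hl => ?_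
  gcongr
  by_cases h : ENNReal.ofReal l < T
  · simp only [h, measure_univ, ofPred_true]
    exact superLevel_tsum_le_one_zero hr hf
      (fun n _ => superLevel_ne_top_of_outerLp hp hp' (ENNReal.ne_top_of_tsum_ne_top ht n))
      hTt (by simpa using hl)
  · refine (superLevel_le (A := ∅) MeasurableSet.empty ?_).trans
      (dyadicOuter_empty.le.trans zero_le)
    rw [compl_empty, indicator_univ]
    exact (outerSup_tsum_le hr hf).trans (not_lt.1 h)

end DimensionZero

/-- Quasi-triangle inequality in the upper half space (Theorem 1.2(iii)): for
`1 ≤ p ≤ ∞` and `1 ≤ r ≤ ∞` there is a constant `C = C(p,r)` such that for every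
sequence of nonnegative Borel functions `f_n` on `ℝ^d × (0,∞)`,
`‖Σ_n f_n‖_{L^p(ℓ^r)} ≤ C Σ_n ‖f_n‖_{L^p(ℓ^r)}`. -/
theorem triangle_inequality_upper_half_space (d : ℕ) (p r : ℝ≥0∞) (hp : 1 ≤ p) (hr : 1 ≤ r) :
    ∃ C : ℝ≥0∞, 0 < C ∧ C ≠ ∞ ∧
      ∀ f : ℕ → UHS d → ℝ≥0∞, (∀ n, Measurable (f n)) →
        outerLp (dyadicOuter d) (uhsMeasure d) p r (fun q => ∑' n, f n q) ≤
          C * ∑' n, outerLp (dyadicOuter d) (uhsMeasure d) p r (f n) := by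
  rcases eq_or_ne p ∞ with rfl | hp'
  · refine ⟨1, one_pos, ENNReal.one_ne_top, fun f hf => ?_⟩
    simp only [outerLp, if_true, one_mul]
    exact outerSup_tsum_le hr hf
  rcases eq_or_ne d 0 with rfl | hd
  · exact ⟨4, by norm_num, by simp, fun f hf => outerLp_tsum_le_zero hp hp' hr hf⟩
  have hP1 := toReal_one_le hp hp'
  have hP0 : 0 < p.toReal := by linarith
  have h2t : ∀ x : ℝ, 0 ≤ x → (2:ℝ≥0∞) ^ x ≠ ∞ := fun x hx =>
    ENNReal.rpow_ne_top_of_nonneg hx (by simp)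
  have hle : ∀ l : ℝ≥0∞, l ≤ 2 * l := fun l => le_mul_of_one_le_left' (by norm_num)
  rcases eq_or_ne r ∞ with rfl | hr'
  · exact outerLp_tsum_le_of_functional hp hp' (whitneyMax d) measurable_whitneyMax
      (fun f _ => whitneyMax_tsum_le f)
      (fun f _ l _ _ => (superLevel_antitone f (hle l)).trans (superLevel_whitneyMax_le hd f l))
      (h2t _ hP0.le) fun f _ A _ hsize _ => lintegral_whitneyMax_le hP0 hsize
  have hρ1 := toReal_one_le hr hr'
  rcases le_or_gt p.toReal r.toReal with hpr | hpr
  · exact outerLp_tsum_le_of_functional hp hp' (dyadicArea d r.toReal) (measurable_dyadicArea _)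
      (fun f hf => dyadicArea_tsum_le hρ1 hf)
      (fun f _ l hl0 hl => superLevel_dyadicArea_le hd hr hr' f hl0 hl)
      (ENNReal.mul_ne_top (by simp) (h2t _ hP0.le))
      fun f _ A hA hsize hsum => lintegral_dyadicArea_le hP0 hr hr' hpr hA hsize hsum
  · refine outerLp_tsum_le_of_functional hp hp' (dyadicCarleson d r.toReal)
      (measurable_dyadicCarleson _) (fun f hf => dyadicCarleson_tsum_le hρ1 hf)
      (fun f _ l hl0 hl => (superLevel_antitone f (hle l)).trans
        (superLevel_dyadicCarleson_le hd hr hr' f hl0 hl)) ?_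
      fun f _ A hA hsize hsum => lintegral_dyadicCarleson_le hd hr hr' hpr hA hsize hsum
    refine ENNReal.mul_ne_top (ENNReal.mul_ne_top (ENNReal.mul_ne_top (h2t _ hP0.le)
      (h2t _ hP0.le)) (h2t _ (by linarith))) (ENNReal.inv_ne_top.2 (tsub_pos_of_lt ?_).ne')
    exact ENNReal.rpow_lt_one_of_one_lt_of_neg (by norm_num) (by linarith)

end
end

section
/- Hardy-Littlewood-Sobolev inequality (Theorem 7.1): Let d ≥ 1, 1 < p, q < ∞ and 0 < α < d satisfy 1/p + 1/q + α/d = 2. There exists a constant C = C(p,q,d) such that for all nonnegative measurable functions f, g on ℝ^d, ∫_{ℝ^d} ∫_{ℝ^d} f(x) g(y) |x−y|^{-α} dx dy ≤ C ‖f‖_{L^p(ℝ^d)} ‖g‖_{L^q(ℝ^d)}. -/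
open MeasureTheory Set
open scoped ENNReal

noncomputable section

/-- The Euclidean distance on `ℝ^d` realized as `Fin d → ℝ`. -/
def eudist {d : ℕ} (x y : Fin d → ℝ) : ℝ := Real.sqrt (∑ i, (x i - y i) ^ 2)

/-- The radial profile `r ↦ min (r ^ (-α)) (r ^ (-β))`. When `α < dim E < β`, it is integrable
as a function of the norm on `E`. -/
def minRpow (α β r : ℝ) : ℝ := min (r ^ (-α)) (r ^ (-β))

lemma measurable_minRpow (α β : ℝ) : Measurable (minRpow α β) := by
  unfold minRpow; fun_prop

section Haar

variable {E : Type*} [NormedAddCommGroup E] [NormedSpace ℝ E] [FiniteDimensional ℝ E]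
  [MeasurableSpace E] [BorelSpace E] (μ : Measure E) [μ.IsAddHaarMeasure]

lemma lintegral_minRpow_norm_lt_top [Nontrivial E] {α β : ℝ}
    (hα : α < Module.finrank ℝ E) (hβ : Module.finrank ℝ E < β) :
    ∫⁻ z, ENNReal.ofReal (minRpow α β ‖z‖) ∂μ < ∞ := by
  have hn : 1 ≤ Module.finrank ℝ E := Module.finrank_pos
  have key : Integrable (fun z : E ↦ minRpow α β ‖z‖) μ := by
    rw [integrable_fun_norm_addHaar μ (f := minRpow α β), ← Ioc_union_Ioi_eq_Ioi zero_le_one]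
    have hm : Measurable fun y : ℝ ↦ y ^ (Module.finrank ℝ E - 1) • minRpow α β y := by
      have := measurable_minRpow α β
      fun_prop
    have hpow (γ y : ℝ) (hy : 0 < y) :
        y ^ ((Module.finrank ℝ E : ℝ) - 1 - γ) = y ^ (Module.finrank ℝ E - 1) * y ^ (-γ) := by
      rw [← Real.rpow_natCast, ← Real.rpow_add hy, Nat.cast_sub hn, Nat.cast_one, sub_eq_add_neg]
    have hnonneg (y : ℝ) (hy : 0 < y) : 0 ≤ minRpow α β y :=
      le_min (Real.rpow_nonneg hy.le _) (Real.rpow_nonneg hy.le _)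
    refine IntegrableOn.union ?_ ?_
    · have h0 : IntegrableOn (fun y : ℝ ↦ y ^ ((Module.finrank ℝ E : ℝ) - 1 - α)) (Ioc 0 1) := by
        rw [← intervalIntegrable_iff_integrableOn_Ioc_of_le zero_le_one]
        exact intervalIntegral.intervalIntegrable_rpow' (by linarith)
      refine h0.mono' hm.aestronglyMeasurable ?_
      filter_upwards [ae_restrict_mem measurableSet_Ioc] with y hy
      have hy0 : 0 < y := hy.1
      rw [smul_eq_mul, Real.norm_of_nonneg (mul_nonneg (by positivity) (hnonneg y hy0)),
        hpow _ _ hy0]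
      gcongr
      exact min_le_left _ _
    · have h0 : IntegrableOn (fun y : ℝ ↦ y ^ ((Module.finrank ℝ E : ℝ) - 1 - β)) (Ioi 1) :=
        integrableOn_Ioi_rpow_of_lt (by linarith) zero_lt_one
      refine h0.mono' hm.aestronglyMeasurable ?_
      filter_upwards [ae_restrict_mem measurableSet_Ioi] with y hy
      have hy0 : 0 < y := zero_lt_one.trans hy
      rw [smul_eq_mul, Real.norm_of_nonneg (mul_nonneg (by positivity) (hnonneg y hy0)),
        hpow _ _ hy0]
      gcongr
      exact min_le_right _ _
  exact key.lintegral_lt_top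

lemma lintegral_comp_smul_addHaar {h : E → ℝ≥0∞} (hh : Measurable h) {t : ℝ} (ht : 0 < t) :
    ∫⁻ z, h (t • z) ∂μ = ENNReal.ofReal ((t ^ Module.finrank ℝ E)⁻¹) * ∫⁻ z, h z ∂μ := by
  rw [← lintegral_map hh (measurable_const_smul t), Measure.map_addHaar_smul μ ht.ne',
    lintegral_smul_measure, abs_of_pos (by positivity), smul_eq_mul]

lemma lintegral_sq_mul_minRpow_le [Nontrivial E] (α β : ℝ) {s : ℝ} (hs : 0 ≤ s) (x : E) :
    ∫⁻ y, ENNReal.ofReal (s ^ 2 * minRpow α β (s ^ (Module.finrank ℝ E : ℝ)⁻¹ * ‖x - y‖)) ∂μ ≤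
      ENNReal.ofReal s * ∫⁻ z, ENNReal.ofReal (minRpow α β ‖z‖) ∂μ := by
  obtain rfl | hs := hs.eq_or_lt
  · simp
  have hn : Module.finrank ℝ E ≠ 0 := Module.finrank_pos.ne'
  have hm : Measurable fun z : E ↦ ENNReal.ofReal (minRpow α β ‖z‖) :=
    ((measurable_minRpow α β).comp measurable_norm).ennreal_ofReal
  have ht : 0 < s ^ (Module.finrank ℝ E : ℝ)⁻¹ := by positivity
  rw [lintegral_sub_left_eq_self (μ := μ)
    (fun z ↦ ENNReal.ofReal (s ^ 2 * minRpow α β (s ^ (Module.finrank ℝ E : ℝ)⁻¹ * ‖z‖)))]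
  have := lintegral_comp_smul_addHaar μ hm ht
  simp only [norm_smul, Real.norm_of_nonneg ht.le] at this
  simp_rw [ENNReal.ofReal_mul (sq_nonneg s)]
  rw [lintegral_const_mul _ (by have := measurable_minRpow α β; fun_prop), this, ← mul_assoc,
    ← ENNReal.ofReal_mul (sq_nonneg s), Real.rpow_inv_natCast_pow hs.le hn]
  apply le_of_eq
  congr 2
  field_simp

end Haar

lemma rpow_mul_rpow_mul_rpow_neg_le_of_le {n α a b s t r : ℝ} (hn : 0 < n)
    (hb : 0 < b) (habα : a + b + α / n = 2) (ht : 0 < t) (hr : 0 < r)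
    (hts : t ≤ s) (htr : t ≤ r ^ (-n)) :
    s ^ a * t ^ b * r ^ (-α) ≤ s ^ 2 * minRpow α (n * b + α) (s ^ n⁻¹ * r) := by
  have hs : 0 < s := ht.trans_le hts
  have hα : α = n * (2 - a - b) := by rw [← habα]; field_simp; ring
  have scale (γ : ℝ) : s ^ 2 * (s ^ n⁻¹ * r) ^ (-γ) = s ^ (2 - γ / n) * r ^ (-γ) := by
    rw [Real.mul_rpow (by positivity) hr.le, ← Real.rpow_mul hs.le, ← mul_assoc,
      ← Real.rpow_natCast, ← Real.rpow_add hs]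
    congr 2
    push_cast
    ring
  rw [minRpow, mul_min_of_nonneg _ _ (sq_nonneg s), scale, scale, le_min_iff]
  constructor
  · rw [show 2 - α / n = a + b by linarith, Real.rpow_add hs]
    gcongr
  · rw [show 2 - (n * b + α) / n = a by rw [hα]; field_simp; ring,
      show -(n * b + α) = -n * b + -α by ring, Real.rpow_add hr, Real.rpow_mul hr.le, mul_assoc]
    gcongr

lemma rpow_mul_rpow_mul_rpow_neg_le {n α a b s t r : ℝ} (hn : 0 < n)
    (ha : 0 < a) (ha1 : a < 1) (hb : 0 < b) (hb1 : b < 1)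
    (habα : a + b + α / n = 2) (hs : 0 < s) (ht : 0 < t) (hr : 0 < r) :
    s ^ a * t ^ b * r ^ (-α) ≤ s * t + s ^ 2 * minRpow α (n * b + α) (s ^ n⁻¹ * r) +
      t ^ 2 * minRpow α (n * a + α) (t ^ n⁻¹ * r) := by
  have hs' : 0 ≤ s ^ 2 * minRpow α (n * b + α) (s ^ n⁻¹ * r) := by unfold minRpow; positivity
  have ht' : 0 ≤ t ^ 2 * minRpow α (n * a + α) (t ^ n⁻¹ * r) := by unfold minRpow; positivity
  have hst : 0 < s * t := by positivity
  have hrn : 0 < r ^ (-n) := by positivity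
  by_cases h : r ^ (-n) ≤ s ∧ r ^ (-n) ≤ t
  · have hα : α = n * (1 - a) + n * (1 - b) := by
      have : α = n * (2 - a - b) := by rw [← habα]; field_simp; ring
      linarith
    have hrα : r ^ (-α) = (r ^ (-n)) ^ (1 - a) * (r ^ (-n)) ^ (1 - b) := by
      rw [← Real.rpow_mul hr.le, ← Real.rpow_mul hr.le, ← Real.rpow_add hr, hα]
      congr 1
      ring
    have : s ^ a * t ^ b * r ^ (-α) ≤ s * t := by
      calc s ^ a * t ^ b * r ^ (-α) ≤ s ^ a * t ^ b * (s ^ (1 - a) * t ^ (1 - b)) := by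
            have := sub_pos.2 ha1
            have := sub_pos.2 hb1
            rw [hrα]
            gcongr
            exacts [h.1, h.2]
        _ = (s ^ a * s ^ (1 - a)) * (t ^ b * t ^ (1 - b)) := by ring
        _ = s * t := by
            rw [← Real.rpow_add hs, ← Real.rpow_add ht]
            simp
    linarith
  · rcases le_total t s with hts | hst'
    · have htr : t ≤ r ^ (-n) := by
        by_contra! h'
        exact h ⟨h'.le.trans hts, h'.le⟩
      linarith [rpow_mul_rpow_mul_rpow_neg_le_of_le hn hb habα ht hr hts htr]
    · have hsr : s ≤ r ^ (-n) := by
        by_contra! h'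
        exact h ⟨h'.le, h'.le.trans hst'⟩
      have := rpow_mul_rpow_mul_rpow_neg_le_of_le (a := b) hn ha (by linarith) hs hr hst' hsr
      rw [mul_comm (t ^ b)] at this
      linarith

section Haar

variable {E : Type*} [NormedAddCommGroup E] [NormedSpace ℝ E] [FiniteDimensional ℝ E]
  [MeasurableSpace E] [BorelSpace E] (μ : Measure E) [μ.IsAddHaarMeasure]

/-- The radial kernel `minRpow α β`, rescaled at each point `x` according to the value `H x`. -/
def rescaledKernel (α β : ℝ) (H : E → ℝ≥0∞) (x y : E) : ℝ≥0∞ := ENNReal.ofReal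
  ((H x).toReal ^ 2 * minRpow α β ((H x).toReal ^ (Module.finrank ℝ E : ℝ)⁻¹ * ‖x - y‖))

lemma measurable_rescaledKernel (α β : ℝ) {H : E → ℝ≥0∞} (hH : Measurable H) :
    Measurable (Function.uncurry (rescaledKernel α β H)) := by
  have := measurable_minRpow α β
  simp only [rescaledKernel, Function.uncurry_def]
  fun_prop

lemma lintegral_rescaledKernel_le [Nontrivial E] (α β : ℝ) {H : E → ℝ≥0∞} (hH : Measurable H)
    (hH1 : ∫⁻ x, H x ∂μ ≤ 1) :
    ∫⁻ x, ∫⁻ y, rescaledKernel α β H x y ∂μ ∂μ ≤ ∫⁻ z, ENNReal.ofReal (minRpow α β ‖z‖) ∂μ := by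
  calc ∫⁻ x, ∫⁻ y, rescaledKernel α β H x y ∂μ ∂μ
      ≤ ∫⁻ x, H x * ∫⁻ z, ENNReal.ofReal (minRpow α β ‖z‖) ∂μ ∂μ := by
        refine lintegral_mono fun x ↦ ?_
        refine (lintegral_sq_mul_minRpow_le μ α β ENNReal.toReal_nonneg x).trans ?_
        gcongr
        exact ENNReal.ofReal_toReal_le
    _ = (∫⁻ x, H x ∂μ) * ∫⁻ z, ENNReal.ofReal (minRpow α β ‖z‖) ∂μ := lintegral_mul_const _ hH
    _ ≤ _ := mul_le_of_le_one_left' hH1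

lemma lintegral_lintegral_rpow_mul_rpow_mul_enorm_rpow_le [Nontrivial E] {α a b : ℝ}
    (ha : 0 < a) (ha1 : a < 1) (hb : 0 < b) (hb1 : b < 1)
    (habα : a + b + α / Module.finrank ℝ E = 2) {F G : E → ℝ≥0∞} (hF : Measurable F)
    (hG : Measurable G) (hF1 : ∫⁻ x, F x ∂μ ≤ 1) (hG1 : ∫⁻ y, G y ∂μ ≤ 1) :
    ∫⁻ x, ∫⁻ y, F x ^ a * G y ^ b * ‖x - y‖ₑ ^ (-α) ∂μ ∂μ ≤
      1 + ∫⁻ z, ENNReal.ofReal (minRpow α (Module.finrank ℝ E * b + α) ‖z‖) ∂μ +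
        ∫⁻ z, ENNReal.ofReal (minRpow α (Module.finrank ℝ E * a + α) ‖z‖) ∂μ := by
  obtain ⟨n, hn_def⟩ : ∃ n : ℝ, n = Module.finrank ℝ E := ⟨_, rfl⟩
  have hn : 0 < n := by simpa [hn_def] using Module.finrank_pos (R := ℝ) (M := E)
  rw [← hn_def] at habα ⊢
  have hFtop : ∀ᵐ x ∂μ, F x < ∞ := ae_lt_top hF (hF1.trans_lt ENNReal.one_lt_top).ne
  have hGtop : ∀ᵐ y ∂μ, G y < ∞ := ae_lt_top hG (hG1.trans_lt ENNReal.one_lt_top).ne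
  have pointwise : ∀ᵐ x ∂μ, ∀ᵐ y ∂μ, F x ^ a * G y ^ b * ‖x - y‖ₑ ^ (-α) ≤
      F x * G y + rescaledKernel α (n * b + α) F x y + rescaledKernel α (n * a + α) G y x := by
    filter_upwards [hFtop] with x hx
    filter_upwards [hGtop, Measure.ae_ne μ x] with y hy hxy
    by_cases hFx : F x = 0
    · simp [hFx, ha]
    by_cases hGy : G y = 0
    · simp [hGy, hb]
    have hs := ENNReal.toReal_pos hFx hx.ne
    have ht := ENNReal.toReal_pos hGy hy.ne
    have hr : 0 < ‖x - y‖ := norm_pos_iff.2 (sub_ne_zero.2 (Ne.symm hxy))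
    have := ENNReal.ofReal_le_ofReal
      (rpow_mul_rpow_mul_rpow_neg_le hn ha ha1 hb hb1 habα hs ht hr)
    rw [ENNReal.ofReal_mul (by positivity), ENNReal.ofReal_mul (by positivity),
      ← ENNReal.ofReal_rpow_of_pos hs, ← ENNReal.ofReal_rpow_of_pos ht,
      ← ENNReal.ofReal_rpow_of_pos hr, ENNReal.ofReal_toReal hx.ne, ENNReal.ofReal_toReal hy.ne,
      ofReal_norm] at this
    refine this.trans (ENNReal.ofReal_add_le.trans ?_)
    simp only [rescaledKernel, ← hn_def, norm_sub_rev y x]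
    gcongr
    refine ENNReal.ofReal_add_le.trans ?_
    rw [ENNReal.ofReal_mul hs.le, ENNReal.ofReal_toReal hx.ne, ENNReal.ofReal_toReal hy.ne]
  have hKF := measurable_rescaledKernel (E := E) α (n * b + α) hF
  have hKG : Measurable (Function.uncurry fun x y ↦ rescaledKernel α (n * a + α) G y x) := by
    have := measurable_minRpow α (n * a + α)
    simp only [rescaledKernel, Function.uncurry_def]
    fun_prop
  calc ∫⁻ x, ∫⁻ y, F x ^ a * G y ^ b * ‖x - y‖ₑ ^ (-α) ∂μ ∂μ
      ≤ ∫⁻ x, ∫⁻ y, (F x * G y + rescaledKernel α (n * b + α) F x y +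
          rescaledKernel α (n * a + α) G y x) ∂μ ∂μ :=
        lintegral_mono_ae (pointwise.mono fun x hx ↦ lintegral_mono_ae hx)
    _ = ∫⁻ x, (F x * ∫⁻ y, G y ∂μ + ∫⁻ y, rescaledKernel α (n * b + α) F x y ∂μ
          + ∫⁻ y, rescaledKernel α (n * a + α) G y x ∂μ) ∂μ := by
        refine lintegral_congr fun x ↦ ?_
        rw [lintegral_add_right _ (hKG.of_uncurry_left (x := x)),
          lintegral_add_right _ (hKF.of_uncurry_left (x := x)), lintegral_const_mul _ hG]
    _ = (∫⁻ x, F x ∂μ) * ∫⁻ y, G y ∂μ + ∫⁻ x, ∫⁻ y, rescaledKernel α (n * b + α) F x y ∂μ ∂μ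
          + ∫⁻ x, ∫⁻ y, rescaledKernel α (n * a + α) G y x ∂μ ∂μ := by
        rw [lintegral_add_right _ hKG.lintegral_prod_right, lintegral_add_right _
          hKF.lintegral_prod_right, lintegral_mul_const _ hF]
    _ ≤ _ := by
        rw [lintegral_lintegral_swap hKG.aemeasurable]
        exact add_le_add (add_le_add (mul_le_one' hF1 hG1)
          (lintegral_rescaledKernel_le μ _ _ hF hF1)) (lintegral_rescaledKernel_le μ _ _ hG hG1)

/-- The Hardy-Littlewood-Sobolev inequality for an arbitrary norm and Haar measure. -/
lemma exists_lintegral_lintegral_mul_enorm_rpow_le [Nontrivial E] {p q α : ℝ}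
    (hp : 1 < p) (hq : 1 < q) (hα : α < Module.finrank ℝ E)
    (hscaling : 1 / p + 1 / q + α / Module.finrank ℝ E = 2) :
    ∃ C : ℝ≥0∞, C ≠ ∞ ∧ ∀ f g : E → ℝ≥0∞, Measurable f → Measurable g →
      ∫⁻ x, ∫⁻ y, f x * g y * ‖x - y‖ₑ ^ (-α) ∂μ ∂μ ≤
        C * (∫⁻ x, f x ^ p ∂μ) ^ p⁻¹ * (∫⁻ y, g y ^ q ∂μ) ^ q⁻¹ := by
  have hn : (0 : ℝ) < Module.finrank ℝ E := by
    simpa using Module.finrank_pos (R := ℝ) (M := E)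
  have hp0 : 0 < p := by linarith
  have hq0 : 0 < q := by linarith
  have hp1 : p⁻¹ < 1 := inv_lt_one_of_one_lt₀ hp
  have hq1 : q⁻¹ < 1 := inv_lt_one_of_one_lt₀ hq
  have hpq : p⁻¹ + q⁻¹ + α / Module.finrank ℝ E = 2 := by simpa using hscaling
  have hβ : (Module.finrank ℝ E : ℝ) < Module.finrank ℝ E * q⁻¹ + α := by
    have : 1 < q⁻¹ + α / Module.finrank ℝ E := by linarith
    calc (Module.finrank ℝ E : ℝ) < Module.finrank ℝ E * (q⁻¹ + α / Module.finrank ℝ E) :=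
          lt_mul_of_one_lt_right hn this
      _ = _ := by field_simp
  have hβ' : (Module.finrank ℝ E : ℝ) < Module.finrank ℝ E * p⁻¹ + α := by
    have : 1 < p⁻¹ + α / Module.finrank ℝ E := by linarith
    calc (Module.finrank ℝ E : ℝ) < Module.finrank ℝ E * (p⁻¹ + α / Module.finrank ℝ E) :=
          lt_mul_of_one_lt_right hn this
      _ = _ := by field_simp
  refine ⟨1 + ∫⁻ z, ENNReal.ofReal (minRpow α (Module.finrank ℝ E * q⁻¹ + α) ‖z‖) ∂μ +
    ∫⁻ z, ENNReal.ofReal (minRpow α (Module.finrank ℝ E * p⁻¹ + α) ‖z‖) ∂μ, ?_, ?_⟩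
  · simp [(lintegral_minRpow_norm_lt_top μ hα hβ).ne, (lintegral_minRpow_norm_lt_top μ hα hβ').ne]
  intro f g hf hg
  set C := 1 + ∫⁻ z, ENNReal.ofReal (minRpow α (Module.finrank ℝ E * q⁻¹ + α) ‖z‖) ∂μ +
    ∫⁻ z, ENNReal.ofReal (minRpow α (Module.finrank ℝ E * p⁻¹ + α) ‖z‖) ∂μ with hC
  have hC0 : C ≠ 0 := by simp [hC]
  set A := ∫⁻ x, f x ^ p ∂μ with hA
  set B := ∫⁻ y, g y ^ q ∂μ with hB
  by_cases hA0 : A = 0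
  · have hf0 : ∀ᵐ x ∂μ, f x = 0 := by
      filter_upwards [(lintegral_eq_zero_iff (hf.pow_const p)).1 hA0] with x hx
      simpa [hp0, hp0.le, hp0.not_gt] using hx
    rw [lintegral_eq_zero_of_ae_eq_zero]
    · exact zero_le
    · filter_upwards [hf0] with x hx
      simp [hx]
  by_cases hB0 : B = 0
  · have hg0 : ∀ᵐ y ∂μ, g y = 0 := by
      filter_upwards [(lintegral_eq_zero_iff (hg.pow_const q)).1 hB0] with x hx
      simpa [hq0, hq0.le, hq0.not_gt] using hx
    rw [lintegral_eq_zero_of_ae_eq_zero]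
    · exact zero_le
    · refine .of_forall fun x ↦ lintegral_eq_zero_of_ae_eq_zero ?_
      filter_upwards [hg0] with y hy
      simp [hy]
  have hAp : A ^ p⁻¹ ≠ 0 := by simp [hA0, hp0.le]
  have hBq : B ^ q⁻¹ ≠ 0 := by simp [hB0, hq0.le]
  by_cases hAt : A = ∞
  · rw [hAt, ENNReal.top_rpow_of_pos (by positivity), ENNReal.mul_top hC0, ENNReal.top_mul hBq]
    exact le_top
  by_cases hBt : B = ∞
  · rw [hBt, ENNReal.top_rpow_of_pos (by positivity), ENNReal.mul_top (mul_ne_zero hC0 hAp)]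
    exact le_top
  have normalize {r I : ℝ≥0∞} {s : ℝ} (hs : 0 < s) (hI0 : I ≠ 0) (hIt : I ≠ ∞) :
      r = I ^ s⁻¹ * (I⁻¹ * r ^ s) ^ s⁻¹ := by
    rw [ENNReal.mul_rpow_of_nonneg _ _ (by positivity), ENNReal.rpow_rpow_inv hs.ne', ← mul_assoc,
      ← ENNReal.mul_rpow_of_nonneg _ _ (by positivity), ENNReal.mul_inv_cancel hI0 hIt,
      ENNReal.one_rpow, one_mul]
  have main := lintegral_lintegral_rpow_mul_rpow_mul_enorm_rpow_le μ (a := p⁻¹) (b := q⁻¹)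
    (by positivity) hp1 (by positivity) hq1 hpq
    ((hf.pow_const p).const_mul A⁻¹) ((hg.pow_const q).const_mul B⁻¹)
    (by rw [lintegral_const_mul _ (hf.pow_const p), ENNReal.inv_mul_cancel hA0 hAt])
    (by rw [lintegral_const_mul _ (hg.pow_const q), ENNReal.inv_mul_cancel hB0 hBt])
  calc ∫⁻ x, ∫⁻ y, f x * g y * ‖x - y‖ₑ ^ (-α) ∂μ ∂μ
      = ∫⁻ x, ∫⁻ y, A ^ p⁻¹ * B ^ q⁻¹ * ((A⁻¹ * f x ^ p) ^ p⁻¹ * (B⁻¹ * g y ^ q) ^ q⁻¹ *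
          ‖x - y‖ₑ ^ (-α)) ∂μ ∂μ := by
        refine lintegral_congr fun x ↦ lintegral_congr fun y ↦ ?_
        conv_lhs => rw [normalize (r := f x) hp0 hA0 hAt, normalize (r := g y) hq0 hB0 hBt]
        ring
    _ = A ^ p⁻¹ * B ^ q⁻¹ * ∫⁻ x, ∫⁻ y, (A⁻¹ * f x ^ p) ^ p⁻¹ * (B⁻¹ * g y ^ q) ^ q⁻¹ *
          ‖x - y‖ₑ ^ (-α) ∂μ ∂μ := by
        have hABt : A ^ p⁻¹ * B ^ q⁻¹ ≠ ∞ := by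
          refine ENNReal.mul_ne_top ?_ ?_ <;>
            exact ENNReal.rpow_ne_top_of_nonneg (by positivity) ‹_›
        simp_rw [lintegral_const_mul' _ _ hABt]
    _ ≤ A ^ p⁻¹ * B ^ q⁻¹ * C := by gcongr
    _ = C * A ^ p⁻¹ * B ^ q⁻¹ := by ring

end Haar

lemma norm_sub_le_eudist {d : ℕ} (x y : Fin d → ℝ) : ‖x - y‖ ≤ eudist x y := by
  refine (pi_norm_le_iff_of_nonneg (Real.sqrt_nonneg _)).2 fun i ↦ ?_
  refine Real.le_sqrt_of_sq_le ?_
  rw [Pi.sub_apply, Real.norm_eq_abs, sq_abs]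
  exact Finset.single_le_sum (f := fun i ↦ (x i - y i) ^ 2) (fun _ _ ↦ sq_nonneg _)
    (Finset.mem_univ i)

/-- The Hardy-Littlewood-Sobolev inequality (Theorem 7.1): for `1 < p, q < ∞` and
`0 < α < d` with `1/p + 1/q + α/d = 2` there is a constant `C = C(p,q,d)` such that for
all nonnegative measurable `f, g` on `ℝ^d`,
`∫∫ f(x) g(y) |x−y|^{-α} dx dy ≤ C ‖f‖_{L^p} ‖g‖_{L^q}`. -/
theorem hls_inequality (d : ℕ) (hd : 1 ≤ d) (p q α : ℝ)
    (hp : 1 < p) (hq : 1 < q) (hα0 : 0 < α) (hαd : α < d)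
    (hscaling : 1 / p + 1 / q + α / d = 2) :
    ∃ C : ℝ≥0∞, C ≠ ∞ ∧
      ∀ f g : (Fin d → ℝ) → ℝ≥0∞, Measurable f → Measurable g →
        (∫⁻ x, ∫⁻ y, f x * g y * ENNReal.ofReal (eudist x y) ^ (-α)) ≤
          C * (∫⁻ x, f x ^ p) ^ p⁻¹ * (∫⁻ y, g y ^ q) ^ q⁻¹ := by
  have : Nonempty (Fin d) := ⟨⟨0, hd⟩⟩
  obtain ⟨C, hC, h⟩ := exists_lintegral_lintegral_mul_enorm_rpow_le
    (volume : Measure (Fin d → ℝ)) (α := α) hp hq (by simpa using hαd) (by simpa using hscaling)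
  refine ⟨C, hC, fun f g hf hg ↦ le_trans ?_ (h f g hf hg)⟩
  refine lintegral_mono fun x ↦ lintegral_mono fun y ↦ ?_
  dsimp only
  rw [ENNReal.rpow_neg, ENNReal.rpow_neg, ← ofReal_norm]
  gcongr
  exact norm_sub_le_eudist x y

end
end
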